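/- arXiv:2501.00565 — 7 statements merged into one kernel-verified Lean document; each statement's English description precedes it below -/
import Mathlib

section
/- Let d ≥ 1 and let V : ℝ^d → ℝ be C¹ with Z_V := ∫_{ℝ^d} e^{−V(x)} dx < ∞, and suppose ⟨∇V(x), x⟩ ≥ a‖x‖² − b for all x ∈ ℝ^d, where a > 0 and b ≥ 0. Then the second moment of the probability density μ(x) = e^{−V(x)}/Z_V satisfies m_2 := ∫_{ℝ^d} ‖x‖² μ(x) dx ≤ (b + 2d)/a. -/
open Real MeasureTheory
open scoped RealInnerProductSpace

/-- Integrating the dissipativity inequality along the ray `v ↦ e^v x`. -/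
lemma dissipative_ray_bound {E : Type*} [NormedAddCommGroup E] [InnerProductSpace ℝ E]
    [CompleteSpace E] {V : E → ℝ} (hV : Differentiable ℝ V) {a b : ℝ}
    (hdiss : ∀ x, a * ‖x‖ ^ 2 - b ≤ ⟪gradient V x, x⟫) (x : E) {u : ℝ} (hu : 0 ≤ u) :
    V (exp (-u) • x) + a * ((1 - exp (-2 * u)) / 2) * ‖x‖ ^ 2 ≤ V x + b * u := by
  have hder : ∀ v : ℝ, HasDerivAt
      (fun v => V (exp v • x) - a * ‖x‖ ^ 2 * (exp (2 * v) / 2) + b * v)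
      (⟪gradient V (exp v • x), exp v • x⟫ - a * ‖x‖ ^ 2 * exp (2 * v) + b) v := by
    intro v
    have h1 : HasDerivAt (fun v => V (exp v • x)) ⟪gradient V (exp v • x), exp v • x⟫ v := by
      exact (((hV (exp v • x)).hasGradientAt.hasFDerivAt).comp_hasDerivAt v
        ((Real.hasDerivAt_exp v).smul_const x)).congr_deriv (by simp)
    have h2 : HasDerivAt (fun v => exp (2 * v) / 2) (exp (2 * v)) v := by
      exact ((((hasDerivAt_id v).const_mul 2).exp).div_const 2).congr_deriv (by simp)
    have h3 : HasDerivAt (fun v => b * v) b v := by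
      simpa using (hasDerivAt_id v).const_mul b
    exact (h1.sub (h2.const_mul _)).add h3
  have hmono := monotone_of_hasDerivAt_nonneg hder fun v => by
    have h := hdiss (exp v • x)
    have he : exp (2 * v) = exp v ^ 2 := by rw [← Real.exp_nat_mul]; norm_num
    rw [norm_smul, mul_pow, Real.norm_eq_abs, sq_abs] at h
    simp only [Pi.zero_apply]
    rw [he]
    linarith
  have h := hmono (show -u ≤ 0 by linarith)
  simp only [exp_zero, one_smul, mul_zero, add_zero] at h
  rw [show 2 * -u = -2 * u by ring] at h
  linarith

/-- Pointwise comparison of `e^{-V}` with its dilation. -/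
lemma dissipative_exp_bound {E : Type*} [NormedAddCommGroup E] [InnerProductSpace ℝ E]
    [CompleteSpace E] {V : E → ℝ} (hV : Differentiable ℝ V) {a b : ℝ}
    (hdiss : ∀ x, a * ‖x‖ ^ 2 - b ≤ ⟪gradient V x, x⟫) (x : E) {u : ℝ} (hu : 0 ≤ u) :
    exp (-V x) + a * ((1 - exp (-2 * u)) / 2) * (‖x‖ ^ 2 * exp (-V x)) ≤
      exp (b * u) * exp (-V (exp (-u) • x)) := by
  have h := dissipative_ray_bound hV hdiss x hu
  set s := a * ((1 - exp (-2 * u)) / 2) * ‖x‖ ^ 2 with hs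
  calc _ = exp (-V x) * (s + 1) := by rw [hs]; ring
    _ ≤ exp (-V x) * exp s := by gcongr; exact add_one_le_exp s
    _ = exp (-V x + s) := (exp_add _ _).symm
    _ ≤ exp (b * u + -V (exp (-u) • x)) := exp_le_exp.2 (by linarith)
    _ = _ := exp_add _ _

section SecondMoment

variable {E : Type*} [NormedAddCommGroup E] [InnerProductSpace ℝ E] [FiniteDimensional ℝ E]
  [MeasurableSpace E] [BorelSpace E] {V : E → ℝ} {a b : ℝ}

lemma integrable_exp_neg_dilation (hint : Integrable fun x => exp (-V x)) (u : ℝ) :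
    Integrable fun x => exp (-V (exp (-u) • x)) :=
  hint.comp_smul (exp_pos _).ne'

lemma integrable_sq_norm_mul_exp_neg_of_dissipative (hV : Differentiable ℝ V)
    (hint : Integrable fun x => exp (-V x)) (ha : 0 < a)
    (hdiss : ∀ x, a * ‖x‖ ^ 2 - b ≤ ⟪gradient V x, x⟫) :
    Integrable fun x => ‖x‖ ^ 2 * exp (-V x) := by
  have hs : 0 < a * ((1 - exp (-2 * 1 : ℝ)) / 2) := by
    have : exp (-2 * 1 : ℝ) < 1 := exp_lt_one_iff.2 (by norm_num)
    exact mul_pos ha (half_pos (sub_pos.2 this))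
  have hcont : Continuous fun x => ‖x‖ ^ 2 * exp (-V x) :=
    (continuous_norm.pow 2).mul hV.continuous.neg.rexp
  refine (((integrable_exp_neg_dilation hint 1).const_mul (exp (b * 1))).const_mul
    (a * ((1 - exp (-2 * 1 : ℝ)) / 2))⁻¹).mono' hcont.aestronglyMeasurable (.of_forall fun x => ?_)
  rw [Real.norm_of_nonneg (by positivity), le_inv_mul_iff₀ hs]
  linarith [dissipative_exp_bound hV hdiss x zero_le_one, exp_pos (-V x)]

lemma integral_sq_norm_mul_exp_neg_le_dilation (hV : Differentiable ℝ V)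
    (hint : Integrable fun x => exp (-V x)) (ha : 0 < a)
    (hdiss : ∀ x, a * ‖x‖ ^ 2 - b ≤ ⟪gradient V x, x⟫) {u : ℝ} (hu : 0 ≤ u) :
    a * ((1 - exp (-2 * u)) / 2) * ∫ x, ‖x‖ ^ 2 * exp (-V x) ≤
      (exp ((b + Module.finrank ℝ E) * u) - 1) * ∫ x, exp (-V x) := by
  have hint2 := integrable_sq_norm_mul_exp_neg_of_dissipative hV hint ha hdiss
  have h := integral_mono (hint.add (hint2.const_mul (a * ((1 - exp (-2 * u)) / 2))))
    ((integrable_exp_neg_dilation hint u).const_mul (exp (b * u)))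
    fun x => dissipative_exp_bound hV hdiss x hu
  simp only [Pi.add_apply] at h
  rw [integral_add hint (hint2.const_mul _), integral_const_mul, integral_const_mul,
    Measure.integral_comp_smul volume (fun x => exp (-V x)) (exp (-u)), smul_eq_mul,
    abs_of_pos (by positivity), ← exp_nat_mul, ← exp_neg, ← mul_assoc, ← exp_add] at h
  rw [show (b + Module.finrank ℝ E) * u = b * u + -(Module.finrank ℝ E * -u) by ring]
  linarith

/-- The sharp second moment bound for an `(a, b)`-dissipative potential. -/
lemma integral_sq_norm_mul_exp_neg_le (hV : Differentiable ℝ V)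
    (hint : Integrable fun x => exp (-V x)) (ha : 0 < a)
    (hdiss : ∀ x, a * ‖x‖ ^ 2 - b ≤ ⟪gradient V x, x⟫) :
    a * ∫ x, ‖x‖ ^ 2 * exp (-V x) ≤ (b + Module.finrank ℝ E) * ∫ x, exp (-V x) := by
  set M := ∫ x, ‖x‖ ^ 2 * exp (-V x) with hM
  set Z := ∫ x, exp (-V x) with hZ
  set c := b + (Module.finrank ℝ E : ℝ) with hc
  have hder : HasDerivAt
      (fun u => (exp (c * u) - 1) * Z - a * ((1 - exp (-2 * u)) / 2) * M) (c * Z - a * M) 0 := by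
    have h1 : ∀ k : ℝ, HasDerivAt (fun u => exp (k * u)) k 0 := fun k => by
      simpa using ((hasDerivAt_id (0 : ℝ)).const_mul k).exp
    exact ((((h1 c).sub_const 1).mul_const Z).sub
      (((((h1 (-2)).const_sub 1).div_const 2).const_mul a).mul_const M)).congr_deriv (by ring)
  have hnonneg : 0 ≤ c * Z - a * M := by
    refine ge_of_tendsto hder.tendsto_slope_zero_right ?_
    filter_upwards [self_mem_nhdsWithin] with u hu
    have hu : 0 < u := hu
    have h := integral_sq_norm_mul_exp_neg_le_dilation hV hint ha hdiss hu.le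
    refine smul_nonneg (inv_nonneg.2 hu.le) ?_
    simp only [zero_add, mul_zero, exp_zero, sub_self, zero_mul, zero_div, sub_zero]
    exact sub_nonneg.2 h
  linarith

end SecondMoment

/-- If `V : ℝ^d → ℝ` is `C¹` with `∫ e^{-V} < ∞` and `(a,b)`-dissipative,
i.e. `⟨∇V(x), x⟩ ≥ a‖x‖² - b`, then the second moment of `μ = e^{-V}/Z_V` is at most
`(b + 2d)/a` (in particular it is finite). -/
theorem second_moment_dissipative
    (d : ℕ) (hd : 1 ≤ d) (V : EuclideanSpace ℝ (Fin d) → ℝ)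
    (hV : ContDiff ℝ 1 V)
    (hint : Integrable fun x : EuclideanSpace ℝ (Fin d) => exp (-V x))
    (a b : ℝ) (ha : 0 < a) (hb : 0 ≤ b)
    (hdiss : ∀ x : EuclideanSpace ℝ (Fin d), a * ‖x‖ ^ 2 - b ≤ ⟪gradient V x, x⟫) :
    ∫⁻ x : EuclideanSpace ℝ (Fin d),
        ENNReal.ofReal (‖x‖ ^ 2 *
          (exp (-V x) / ∫ y : EuclideanSpace ℝ (Fin d), exp (-V y))) ≤
      ENNReal.ofReal ((b + 2 * d) / a) := by
  have hV' : Differentiable ℝ V := hV.differentiable one_ne_zero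
  have hZ : 0 < ∫ y, exp (-V y) := integral_exp_pos hint
  have hint2 := integrable_sq_norm_mul_exp_neg_of_dissipative hV' hint ha hdiss
  have h := integral_sq_norm_mul_exp_neg_le hV' hint ha hdiss
  rw [finrank_euclideanSpace_fin] at h
  simp only [← mul_div_assoc]
  rw [← ofReal_integral_eq_lintegral_ofReal (hint2.div_const _)
    (.of_forall fun x => by positivity), integral_div]
  refine ENNReal.ofReal_le_ofReal ?_
  rw [div_le_div_iff₀ hZ ha]
  have hd0 : (0 : ℝ) ≤ d := d.cast_nonneg
  nlinarith [mul_nonneg hd0 hZ.le]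
end

section
/- Let d ≥ 1 and let V : ℝ^d → ℝ be C² with Z_V := ∫_{ℝ^d} e^{−V(x)} dx < ∞, satisfying ∇²V(x) ⪯ β I_d for all x (β ≥ 0) and ⟨∇V(x), x⟩ ≥ a‖x‖² − b for all x (a > 0, b ≥ 0). Then the relative Fisher information of μ(x) = e^{−V(x)}/Z_V with respect to the standard Gaussian satisfies I(μ, π) := ∫_{ℝ^d} ‖x − ∇V(x)‖² μ(x) dx ≤ 2(b + 2d)/a + 2βd. -/
open Real MeasureTheory
open scoped RealInnerProductSpace

lemma integrable_one_add_norm_sq_mul_exp_neg {E : Type*} [NormedAddCommGroup E]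
    [InnerProductSpace ℝ E] [FiniteDimensional ℝ E] [MeasurableSpace E] [BorelSpace E]
    {c : ℝ} (hc : 0 < c) :
    Integrable fun x : E => (1 + ‖x‖) ^ 2 * exp (-(c * ‖x‖ ^ 2)) := by
  have hgauss : Integrable fun x : E => exp (-(c / 2 * ‖x‖ ^ 2)) := by
    have h := (GaussianFourier.integrable_cexp_neg_mul_sq_norm_add (V := E) (b := (c / 2 : ℝ))
      (by simpa using hc) 0 0).norm
    refine h.congr (.of_forall fun x => ?_)
    have : -((c / 2 : ℝ) : ℂ) * (‖x‖ : ℂ) ^ 2 + 0 * (⟪(0 : E), x⟫ : ℂ)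
        = ((-(c / 2 * ‖x‖ ^ 2) : ℝ) : ℂ) := by
      push_cast
      ring
    simp only [this, Complex.norm_exp_ofReal]
  refine (hgauss.const_mul (2 + 4 / c)).mono' (by fun_prop) (.of_forall fun x => ?_)
  rw [Real.norm_of_nonneg (by positivity)]
  have hexp : exp (-(c * ‖x‖ ^ 2)) = exp (-(c / 2 * ‖x‖ ^ 2)) * exp (-(c / 2 * ‖x‖ ^ 2)) := by
    rw [← exp_add]
    ring_nf
  have hone : exp (c / 2 * ‖x‖ ^ 2) * exp (-(c / 2 * ‖x‖ ^ 2)) = 1 := by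
    rw [← exp_add, add_neg_cancel, exp_zero]
  have hle : (1 + ‖x‖) ^ 2 ≤ (2 + 4 / c) * exp (c / 2 * ‖x‖ ^ 2) := by
    have h1 := add_one_le_exp (c / 2 * ‖x‖ ^ 2)
    have h2 : (2 + 4 / c) * (c / 2 * ‖x‖ ^ 2 + 1) =
        c * ‖x‖ ^ 2 + 2 * ‖x‖ ^ 2 + 2 + 4 / c := by
      field_simp
      ring
    have h3 : (2 + 4 / c) * (c / 2 * ‖x‖ ^ 2 + 1) ≤ (2 + 4 / c) * exp (c / 2 * ‖x‖ ^ 2) := by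
      gcongr
    have h4 : 0 ≤ c * ‖x‖ ^ 2 := by positivity
    have h5 : 0 ≤ 4 / c := by positivity
    nlinarith [sq_nonneg (1 - ‖x‖)]
  calc (1 + ‖x‖) ^ 2 * exp (-(c * ‖x‖ ^ 2))
      ≤ (2 + 4 / c) * exp (c / 2 * ‖x‖ ^ 2) * exp (-(c * ‖x‖ ^ 2)) := by gcongr
    _ = (2 + 4 / c) * (exp (c / 2 * ‖x‖ ^ 2) * exp (-(c / 2 * ‖x‖ ^ 2)))
          * exp (-(c / 2 * ‖x‖ ^ 2)) := by
        rw [hexp]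
        ring
    _ = (2 + 4 / c) * exp (-(c / 2 * ‖x‖ ^ 2)) := by rw [hone, mul_one]

lemma exp_neg_apply_add_le {E : Type*} [NormedAddCommGroup E] {V : E → ℝ} {c C : ℝ}
    (hc : 0 < c) (hcoer : ∀ x, c * ‖x‖ ^ 2 - C ≤ V x)
    (x : E) {w : E} (hw : ‖w‖ ≤ 1) :
    exp (-V (x + w)) ≤ exp (C + c) * exp (-(c / 2 * ‖x‖ ^ 2)) := by
  rw [← exp_add, exp_le_exp]
  have h1 := hcoer (x + w)
  have h2 : ‖x‖ ≤ ‖x + w‖ + 1 := by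
    have := norm_sub_le (x + w) w
    rw [add_sub_cancel_right] at this
    linarith
  have h3 : ‖x‖ ^ 2 ≤ 2 * ‖x + w‖ ^ 2 + 2 := by
    nlinarith [norm_nonneg x, norm_nonneg (x + w), sq_nonneg (‖x + w‖ - 1)]
  nlinarith

/-- Continuous functions of at most quadratic growth are integrable against translates of
`exp (-V)`, for a quadratically coercive potential `V`. -/
lemma integrable_mul_exp_neg_add {E : Type*} [NormedAddCommGroup E] [InnerProductSpace ℝ E]
    [FiniteDimensional ℝ E] [MeasurableSpace E] [BorelSpace E] {V : E → ℝ} (hV : Continuous V)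
    {c C M : ℝ} (hc : 0 < c)
    (hcoer : ∀ x, c * ‖x‖ ^ 2 - C ≤ V x) {f : E → ℝ} (hf : Continuous f)
    (hM : ∀ x, |f x| ≤ M * (1 + ‖x‖) ^ 2) {w : E} (hw : ‖w‖ ≤ 1) :
    Integrable fun x => f x * exp (-V (x + w)) := by
  refine ((integrable_one_add_norm_sq_mul_exp_neg (E := E) (half_pos hc)).const_mul
    (M * exp (C + c))).mono' (by fun_prop) (.of_forall fun x => ?_)
  rw [norm_mul, Real.norm_eq_abs, Real.norm_of_nonneg (exp_pos _).le]
  calc |f x| * exp (-V (x + w))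
      ≤ M * (1 + ‖x‖) ^ 2 * (exp (C + c) * exp (-(c / 2 * ‖x‖ ^ 2))) :=
        mul_le_mul (hM x) (exp_neg_apply_add_le hc hcoer x hw) (exp_pos _).le
          ((abs_nonneg _).trans (hM x))
    _ = _ := by ring

section SemiLogConvex

variable {E : Type*} [NormedAddCommGroup E] [InnerProductSpace ℝ E] [CompleteSpace E]
  {V : E → ℝ}

lemma hasDerivAt_comp_add_smul (hV : Differentiable ℝ V) (x v : E) (t : ℝ) :
    HasDerivAt (fun s : ℝ => V (x + s • v)) ⟪gradient V (x + t • v), v⟫ t := by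
  have h1 : HasDerivAt (fun s : ℝ => x + s • v) v t := by
    simpa using ((hasDerivAt_id t).smul_const v).const_add x
  rw [inner_gradient_left]
  exact (hV (x + t • v)).hasFDerivAt.comp_hasDerivAt t h1

lemma continuous_gradient (hV : ContDiff ℝ 1 V) : Continuous (gradient V) :=
  (InnerProductSpace.toDual ℝ E).symm.continuous.comp (hV.continuous_fderiv one_ne_zero)

/-- An upper bound on the Hessian makes the gradient one-sided Lipschitz. -/
lemma inner_gradient_add_sub_le (hV : ContDiff ℝ 2 V) {β : ℝ}
    (hhess : ∀ x v : E, iteratedFDeriv ℝ 2 V x ![v, v] ≤ β * ‖v‖ ^ 2) (x v : E) :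
    ⟪gradient V (x + v), v⟫ - ⟪gradient V x, v⟫ ≤ β * ‖v‖ ^ 2 := by
  have hd : Differentiable ℝ (fderiv ℝ V) :=
    (hV.fderiv_right (m := 1) (by norm_num)).differentiable one_ne_zero
  have hderiv (t : ℝ) : HasDerivAt (fun s : ℝ => ⟪gradient V (x + s • v), v⟫)
      (iteratedFDeriv ℝ 2 V (x + t • v) ![v, v]) t := by
    have h1 : HasDerivAt (fun s : ℝ => x + s • v) v t := by
      simpa using ((hasDerivAt_id t).smul_const v).const_add x
    have h2 := (hd (x + t • v)).hasFDerivAt.comp_hasDerivAt t h1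
    have h3 := h2.clm_apply (hasDerivAt_const t v)
    simpa [inner_gradient_left, iteratedFDeriv_two_apply] using h3
  obtain ⟨c, -, hc⟩ := exists_hasDerivAt_eq_slope _ _ (zero_lt_one (α := ℝ))
    (fun t _ => (hderiv t).continuousAt.continuousWithinAt) (fun t _ => hderiv t)
  have := hhess (x + c • v) v
  rw [hc] at this
  simpa using this

/-- The quadratic upper bound given by a one-sided Lipschitz gradient. -/
lemma apply_add_le_of_inner_gradient_sub_le (hV : Differentiable ℝ V) {β : ℝ} (hβ : 0 ≤ β)
    (h : ∀ x v : E, ⟪gradient V (x + v), v⟫ - ⟪gradient V x, v⟫ ≤ β * ‖v‖ ^ 2) (x v : E) :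
    V (x + v) ≤ V x + ⟪gradient V x, v⟫ + β * ‖v‖ ^ 2 := by
  obtain ⟨c, ⟨hc0, hc1⟩, hc⟩ := exists_hasDerivAt_eq_slope _ _ (zero_lt_one (α := ℝ))
    (fun t _ => (hasDerivAt_comp_add_smul hV x v t).continuousAt.continuousWithinAt)
    (fun t _ => hasDerivAt_comp_add_smul hV x v t)
  have h1 := h x (c • v)
  simp only [inner_smul_right, norm_smul, Real.norm_eq_abs, mul_pow, sq_abs] at h1
  have h2 : ⟪gradient V (x + c • v), v⟫ - ⟪gradient V x, v⟫ ≤ β * (c * ‖v‖ ^ 2) := by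
    refine le_of_mul_le_mul_left ?_ hc0
    linarith
  have h3 : β * (c * ‖v‖ ^ 2) ≤ β * ‖v‖ ^ 2 := by
    gcongr
    nlinarith [sq_nonneg ‖v‖]
  simp only [one_smul, zero_smul, add_zero, sub_zero, div_one] at hc
  linarith

/-- A dissipative potential grows at least quadratically. -/
lemma exists_sub_le_of_dissipative [FiniteDimensional ℝ E] (hV : Differentiable ℝ V) {a b : ℝ}
    (ha : 0 < a) (hb : 0 ≤ b) (hdiss : ∀ x : E, a * ‖x‖ ^ 2 - b ≤ ⟪gradient V x, x⟫) :
    ∃ C, ∀ x, a / 4 * ‖x‖ ^ 2 - C ≤ V x := by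
  set R : ℝ := √(2 * b / a + 1) with hR
  have hR0 : 0 < R := by positivity
  have hR2 : b ≤ a / 2 * R ^ 2 := by
    rw [hR, Real.sq_sqrt (by positivity)]
    have : a / 2 * (2 * b / a + 1) = b + a / 2 := by field_simp
    linarith
  have hW : Continuous fun x => V x - a / 4 * ‖x‖ ^ 2 := by
    have := hV.continuous
    fun_prop
  obtain ⟨m, hm⟩ := (isCompact_closedBall (0 : E) R).bddBelow_image hW.continuousOn
  have hball (x : E) (hx : ‖x‖ ≤ R) : m ≤ V x - a / 4 * ‖x‖ ^ 2 :=
    hm ⟨x, by simpa using hx, rfl⟩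
  refine ⟨-m, fun x => ?_⟩
  rcases le_or_gt ‖x‖ R with hx | hx
  · linarith [hball x hx]
  have hx0 : 0 < ‖x‖ := hR0.trans hx
  have hderiv (t : ℝ) : HasDerivAt (fun s : ℝ => V (0 + s • x) - a / 4 * (s ^ 2 * ‖x‖ ^ 2))
      (⟪gradient V (0 + t • x), x⟫ - a / 4 * (2 * t * ‖x‖ ^ 2)) t := by
    have := (((hasDerivAt_id t).pow 2).mul_const (‖x‖ ^ 2)).const_mul (a / 4)
    exact (hasDerivAt_comp_add_smul hV 0 x t).sub (by simpa using this)
  have hlt : R / ‖x‖ < 1 := (div_lt_one hx0).2 hx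
  obtain ⟨c, ⟨hc0, -⟩, hc⟩ := exists_hasDerivAt_eq_slope _ _ hlt
    (fun t _ => (hderiv t).continuousAt.continuousWithinAt) (fun t _ => hderiv t)
  have hcpos : 0 < c := (div_pos hR0 hx0).trans hc0
  have hcR : R ≤ c * ‖x‖ := ((div_lt_iff₀ hx0).1 hc0).le
  have h1 := hdiss (c • x)
  simp only [inner_smul_right, norm_smul, Real.norm_eq_abs, mul_pow, sq_abs] at h1
  have h2 : 0 ≤ ⟪gradient V (0 + c • x), x⟫ - a / 4 * (2 * c * ‖x‖ ^ 2) := by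
    have h4 : R ^ 2 ≤ c ^ 2 * ‖x‖ ^ 2 := by
      rw [← mul_pow]
      gcongr
    have h5 : a / 2 * R ^ 2 ≤ a / 2 * (c ^ 2 * ‖x‖ ^ 2) := by gcongr
    rw [zero_add]
    refine le_of_mul_le_mul_left ?_ hcpos
    nlinarith
  rw [hc, le_div_iff₀ (by linarith), zero_mul] at h2
  have h3 := hball ((R / ‖x‖) • x) (by
    rw [norm_smul, Real.norm_of_nonneg (by positivity), div_mul_cancel₀ _ hx0.ne'])
  simp only [norm_smul, Real.norm_eq_abs, mul_pow, sq_abs] at h3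
  simp only [one_smul, zero_add, one_pow, one_mul] at h2
  linarith

/-- If the gradient is one-sided Lipschitz and the potential is bounded below, then the gradient
has linear growth. -/
lemma exists_norm_gradient_le (hV : Differentiable ℝ V) {β C : ℝ} (hβ : 0 ≤ β)
    (h : ∀ x v : E, ⟪gradient V (x + v), v⟫ - ⟪gradient V x, v⟫ ≤ β * ‖v‖ ^ 2)
    (hC : ∀ x, -C ≤ V x) : ∃ L, ∀ x, ‖gradient V x‖ ≤ L * (1 + ‖x‖) := by
  have hup := apply_add_le_of_inner_gradient_sub_le hV hβ h
  refine ⟨|V 0 + C| + ‖gradient V 0‖ + 2 * β, fun x => ?_⟩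
  set r := 1 + ‖x‖ with hr
  have hr1 : 1 ≤ r := by simp [hr]
  rcases eq_or_ne (gradient V x) 0 with h0 | h0
  · rw [h0, norm_zero]
    positivity
  have hn : 0 < ‖gradient V x‖ := norm_pos_iff.2 h0
  have h1 := hup x (-(r / ‖gradient V x‖) • gradient V x)
  have h2 := hup 0 x
  rw [inner_smul_right, norm_smul, real_inner_self_eq_norm_sq, norm_neg,
    Real.norm_of_nonneg (by positivity), div_mul_cancel₀ _ hn.ne'] at h1
  have h3 : -(r / ‖gradient V x‖) * ‖gradient V x‖ ^ 2 = -(r * ‖gradient V x‖) := by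
    field_simp
  rw [h3] at h1
  rw [zero_add] at h2
  have h4 := real_inner_le_norm (gradient V 0) x
  have h5 := hC (x + -(r / ‖gradient V x‖) • gradient V x)
  have h6 : ‖x‖ ≤ r := by simp [hr]
  have h7 : β * ‖x‖ ^ 2 ≤ β * r ^ 2 := by gcongr
  have h8 : ‖gradient V 0‖ * ‖x‖ ≤ ‖gradient V 0‖ * r ^ 2 := by
    gcongr
    nlinarith
  have h9 : V 0 + C ≤ |V 0 + C| * r ^ 2 :=
    (le_abs_self _).trans (le_mul_of_one_le_right (abs_nonneg _) (one_le_pow₀ hr1))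
  refine le_of_mul_le_mul_left ?_ (zero_lt_one.trans_le hr1)
  linarith

variable [FiniteDimensional ℝ E] [MeasurableSpace E] [BorelSpace E]

lemma integral_mul_inner_gradient_mul_exp_neg_le (hV : ContDiff ℝ 1 V) {c C L M K : ℝ}
    (hc : 0 < c) (hcoer : ∀ x, c * ‖x‖ ^ 2 - C ≤ V x)
    (hL : ∀ x, ‖gradient V x‖ ≤ L * (1 + ‖x‖)) {G : E → ℝ} (hG : Continuous G)
    (hM : ∀ x, |G x| ≤ M * (1 + ‖x‖)) {v : E} (hv : ‖v‖ = 1)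
    (hK : ∀ x (t : ℝ), 0 < t → G (x + t • v) - G x ≤ K * t) :
    Integrable (fun x => G x * ⟪gradient V x, v⟫ * exp (-V x)) ∧
      ∫ x, G x * ⟪gradient V x, v⟫ * exp (-V x) ≤ K * ∫ x, exp (-V x) := by
  have hVd : Differentiable ℝ V := hV.differentiable one_ne_zero
  have hVc : Continuous V := hV.continuous
  have hg := continuous_gradient hV
  have hM0 : 0 ≤ M := by simpa using (abs_nonneg _).trans (hM 0)
  have hL0 : 0 ≤ L := by simpa using (norm_nonneg _).trans (hL 0)
  have hnorm {t : ℝ} (ht : t ∈ Metric.ball (0 : ℝ) 1) : ‖t • -v‖ ≤ 1 := by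
    rw [norm_smul, norm_neg, hv, mul_one]
    exact (mem_ball_zero_iff.1 ht).le
  have hM2 (x : E) : |G x| ≤ M * (1 + ‖x‖) ^ 2 := by
    refine (hM x).trans ?_
    gcongr
    exact le_self_pow₀ (by simp) two_ne_zero
  have hF {t : ℝ} (ht : t ∈ Metric.ball (0 : ℝ) 1) :
      Integrable fun x => G x * exp (-V (x + t • -v)) :=
    integrable_mul_exp_neg_add hVc hc hcoer hG hM2 (hnorm ht)
  have hρ : Integrable fun x => exp (-V x) := by
    simpa using integrable_mul_exp_neg_add (f := fun _ => 1) (M := 1) (w := 0) hVc hc hcoer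
      continuous_const (fun x => by
        rw [abs_one, one_mul]
        exact one_le_pow₀ (le_add_of_nonneg_right (norm_nonneg x))) (by simp)
  have h0 : (0 : ℝ) ∈ Metric.ball (0 : ℝ) 1 := Metric.mem_ball_self one_pos
  obtain ⟨hint, hderiv⟩ := hasDerivAt_integral_of_dominated_loc_of_deriv_le
    (μ := volume) (x₀ := (0 : ℝ)) (s := Metric.ball 0 1)
    (F := fun t x => G x * exp (-V (x + t • -v)))
    (F' := fun t x => G x * (exp (-V (x + t • -v)) * -⟪gradient V (x + t • -v), -v⟫))
    (bound := fun x => M * (2 * L) * exp (C + c) *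
      ((1 + ‖x‖) ^ 2 * exp (-(c / 2 * ‖x‖ ^ 2))))
    (Metric.ball_mem_nhds 0 one_pos)
    (.of_forall fun t => by fun_prop) (hF h0) (by fun_prop)
    (.of_forall fun x t ht => by
      have h1 : |⟪gradient V (x + t • -v), -v⟫| ≤ 2 * L * (1 + ‖x‖) := by
        refine (abs_real_inner_le_norm _ _).trans ?_
        rw [norm_neg, hv, mul_one]
        refine (hL _).trans ?_
        rw [mul_comm 2 L, mul_assoc]
        gcongr
        linarith [norm_add_le x (t • -v), hnorm ht, norm_nonneg x]
      rw [norm_mul, norm_mul, norm_neg, Real.norm_eq_abs, Real.norm_eq_abs, Real.norm_eq_abs,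
        abs_of_pos (exp_pos _)]
      calc |G x| * (exp (-V (x + t • -v)) * |⟪gradient V (x + t • -v), -v⟫|)
          ≤ M * (1 + ‖x‖) * (exp (C + c) * exp (-(c / 2 * ‖x‖ ^ 2)) * (2 * L * (1 + ‖x‖))) := by
            gcongr
            · exact hM x
            · exact exp_neg_apply_add_le hc hcoer x (hnorm ht)
        _ = _ := by ring)
    ((integrable_one_add_norm_sq_mul_exp_neg (half_pos hc)).const_mul _)
    (.of_forall fun x t _ => ((hasDerivAt_comp_add_smul hVd x (-v) t).neg.exp).const_mul (G x))
  have hF' : (fun x => G x * (exp (-V (x + (0 : ℝ) • -v)) *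
      -⟪gradient V (x + (0 : ℝ) • -v), -v⟫)) =
      fun x => G x * ⟪gradient V x, v⟫ * exp (-V x) := by
    ext x
    simp only [zero_smul, add_zero, inner_neg_right, neg_neg]
    ring
  simp only [hF'] at hint hderiv
  refine ⟨hint, le_of_tendsto hderiv.tendsto_slope_zero_right ?_⟩
  filter_upwards [Ioo_mem_nhdsGT (zero_lt_one (α := ℝ))] with t ht
  have htb : t ∈ Metric.ball (0 : ℝ) 1 := by
    rw [mem_ball_zero_iff, Real.norm_of_nonneg ht.1.le]
    exact ht.2
  have hint_t : Integrable fun x => G (x + t • v) * exp (-V x) := by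
    simpa [add_assoc] using (hF htb).comp_add_right (t • v)
  have hshift : ∫ x, G x * exp (-V (x + t • -v)) = ∫ x, G (x + t • v) * exp (-V x) := by
    rw [← integral_add_right_eq_self _ (t • v)]
    simp [add_assoc]
  have hint_0 : Integrable fun x => G x * exp (-V x) := by simpa using hF h0
  simp only [zero_add, zero_smul, add_zero, smul_eq_mul]
  rw [hshift, ← integral_sub hint_t hint_0, inv_mul_le_iff₀ ht.1, ← integral_const_mul,
    ← integral_const_mul]
  refine integral_mono (hint_t.sub hint_0) ((hρ.const_mul _).const_mul _) fun x => ?_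
  have := mul_le_mul_of_nonneg_right (hK x t ht.1) (exp_pos (-V x)).le
  simp only
  linarith

/-- For a one-sided Lipschitz vector field `X` of linear growth, integration by parts bounds
`∫ ⟪X, ∇V⟫ e^{-V}`. -/
lemma integral_inner_gradient_mul_exp_neg_le (hV : ContDiff ℝ 1 V) {c C L M K : ℝ}
    (hc : 0 < c) (hcoer : ∀ x, c * ‖x‖ ^ 2 - C ≤ V x)
    (hL : ∀ x, ‖gradient V x‖ ≤ L * (1 + ‖x‖)) {X : E → E} (hX : Continuous X)
    (hM : ∀ x, ‖X x‖ ≤ M * (1 + ‖x‖))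
    (hK : ∀ x v, ⟪X (x + v), v⟫ - ⟪X x, v⟫ ≤ K * ‖v‖ ^ 2) :
    Integrable (fun x => ⟪X x, gradient V x⟫ * exp (-V x)) ∧
      ∫ x, ⟪X x, gradient V x⟫ * exp (-V x) ≤
        Module.finrank ℝ E * K * ∫ x, exp (-V x) := by
  let e := stdOrthonormalBasis ℝ E
  have key (i) := integral_mul_inner_gradient_mul_exp_neg_le hV hc hcoer hL
    (G := fun x => ⟪X x, e i⟫) (M := M) (K := K) (v := e i) (by fun_prop)
    (fun x => (abs_real_inner_le_norm _ _).trans (by simpa using hM x)) (by simp)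
    (fun x t ht => by
      have := hK x (t • e i)
      simp only [inner_smul_right, norm_smul, Real.norm_eq_abs, sq_abs,
        OrthonormalBasis.norm_eq_one, mul_one] at this
      refine le_of_mul_le_mul_left ?_ ht
      linarith)
  have hsum : (fun x => ⟪X x, gradient V x⟫ * exp (-V x)) =
      fun x => ∑ i, ⟪X x, e i⟫ * ⟪gradient V x, e i⟫ * exp (-V x) := by
    ext x
    rw [← e.sum_inner_mul_inner, Finset.sum_mul]
    simp only [real_inner_comm (gradient V x)]
  rw [hsum]
  refine ⟨integrable_finsetSum _ fun i _ => (key i).1, ?_⟩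
  rw [integral_finsetSum _ fun i _ => (key i).1]
  refine (Finset.sum_le_sum fun i _ => (key i).2).trans_eq ?_
  simp [mul_assoc]

end SemiLogConvex

/-- If `V : ℝ^d → ℝ` is `C²` with `∫ e^{-V} < ∞`, `β`-semi-log-convex
(`∇²V ⪯ β I_d`, expressed via the Hessian quadratic form `iteratedFDeriv ℝ 2 V`) and
`(a,b)`-dissipative, then the relative Fisher information of `μ = e^{-V}/Z_V` with respect
to the standard Gaussian, `∫ ‖x - ∇V(x)‖² μ(x) dx`, is at most `2(b + 2d)/a + 2βd`. -/
theorem fisher_information_bound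
    (d : ℕ) (hd : 1 ≤ d) (V : EuclideanSpace ℝ (Fin d) → ℝ)
    (hV : ContDiff ℝ 2 V)
    (hint : Integrable fun x : EuclideanSpace ℝ (Fin d) => exp (-V x))
    (β : ℝ) (hβ : 0 ≤ β)
    (hhess : ∀ x v : EuclideanSpace ℝ (Fin d),
      iteratedFDeriv ℝ 2 V x ![v, v] ≤ β * ‖v‖ ^ 2)
    (a b : ℝ) (ha : 0 < a) (hb : 0 ≤ b)
    (hdiss : ∀ x : EuclideanSpace ℝ (Fin d), a * ‖x‖ ^ 2 - b ≤ ⟪gradient V x, x⟫) :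
    ∫⁻ x : EuclideanSpace ℝ (Fin d),
        ENNReal.ofReal (‖x - gradient V x‖ ^ 2 *
          (exp (-V x) / ∫ y : EuclideanSpace ℝ (Fin d), exp (-V y))) ≤
      ENNReal.ofReal (2 * (b + 2 * d) / a + 2 * β * d) := by
  have hV1 : ContDiff ℝ 1 V := hV.of_le (by norm_num)
  have hVd : Differentiable ℝ V := hV1.differentiable one_ne_zero
  have hone := inner_gradient_add_sub_le hV hhess
  obtain ⟨C, hcoer⟩ := exists_sub_le_of_dissipative hVd ha hb hdiss
  have hbelow (x : EuclideanSpace ℝ (Fin d)) : -C ≤ V x := by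
    have : 0 ≤ a / 4 * ‖x‖ ^ 2 := by positivity
    linarith [hcoer x]
  obtain ⟨L, hL⟩ := exists_norm_gradient_le hVd hβ hone hbelow
  have hc : 0 < a / 4 := by positivity
  obtain ⟨hi1, h1⟩ := integral_inner_gradient_mul_exp_neg_le hV1 hc hcoer hL
    (X := fun x => x) (M := 1) (K := 1) continuous_id (fun x => by simp)
    (fun x v => by simp [inner_add_left])
  obtain ⟨hi2, h2⟩ := integral_inner_gradient_mul_exp_neg_le hV1 hc hcoer hL
    (continuous_gradient hV1) hL hone
  simp only [real_inner_self_eq_norm_sq, finrank_euclideanSpace_fin, mul_one] at h1 hi2 h2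
  have hi3 : Integrable fun x : EuclideanSpace ℝ (Fin d) => ‖x‖ ^ 2 * exp (-V x) := by
    simpa using integrable_mul_exp_neg_add (f := fun x => ‖x‖ ^ 2) (M := 1) (w := 0)
      hV.continuous hc hcoer (by fun_prop)
      (fun x => by
        rw [abs_of_nonneg (by positivity), one_mul]
        gcongr
        simp) (by simp)
  set Z := ∫ y : EuclideanSpace ℝ (Fin d), exp (-V y) with hZ
  have hZ0 : 0 < Z := integral_exp_pos hint
  have h3 : a * ∫ x : EuclideanSpace ℝ (Fin d), ‖x‖ ^ 2 * exp (-V x) ≤ (b + d) * Z := by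
    have hmono : ∫ x : EuclideanSpace ℝ (Fin d), a * (‖x‖ ^ 2 * exp (-V x)) ≤
        ∫ x : EuclideanSpace ℝ (Fin d), (⟪x, gradient V x⟫ * exp (-V x) + b * exp (-V x)) := by
      refine integral_mono (hi3.const_mul a) (hi1.add (hint.const_mul b)) fun x => ?_
      have := mul_le_mul_of_nonneg_right (hdiss x) (exp_pos (-V x)).le
      rw [real_inner_comm] at this
      simp only
      linarith
    rw [integral_const_mul, integral_add hi1 (hint.const_mul b), integral_const_mul] at hmono
    linarith
  have hpt (x : EuclideanSpace ℝ (Fin d)) : ‖x - gradient V x‖ ^ 2 * (exp (-V x) / Z) ≤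
      2 / Z * (‖x‖ ^ 2 * exp (-V x)) + 2 / Z * (‖gradient V x‖ ^ 2 * exp (-V x)) := by
    have hsq : ‖x - gradient V x‖ ^ 2 ≤ 2 * ‖x‖ ^ 2 + 2 * ‖gradient V x‖ ^ 2 := by
      nlinarith [parallelogram_law_with_norm ℝ x (gradient V x), norm_nonneg (x + gradient V x)]
    calc _ ≤ (2 * ‖x‖ ^ 2 + 2 * ‖gradient V x‖ ^ 2) * (exp (-V x) / Z) := by gcongr
      _ = _ := by ring
  refine (lintegral_mono fun x => ENNReal.ofReal_le_ofReal (hpt x)).trans ?_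
  have hi4 : Integrable fun x : EuclideanSpace ℝ (Fin d) =>
      2 / Z * (‖x‖ ^ 2 * exp (-V x)) + 2 / Z * (‖gradient V x‖ ^ 2 * exp (-V x)) :=
    (hi3.const_mul _).add (hi2.const_mul _)
  rw [← ofReal_integral_eq_lintegral_ofReal hi4
    (.of_forall fun x => by positivity)]
  refine ENNReal.ofReal_le_ofReal ?_
  rw [integral_add (hi3.const_mul _) (hi2.const_mul _), integral_const_mul, integral_const_mul]
  have h4 : ∫ x : EuclideanSpace ℝ (Fin d), ‖x‖ ^ 2 * exp (-V x) ≤ (b + d) / a * Z := by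
    rw [div_mul_eq_mul_div, le_div_iff₀ ha]
    linarith
  calc _ ≤ 2 / Z * ((b + d) / a * Z) + 2 / Z * (d * β * Z) := by gcongr
    _ = 2 * (b + d) / a + 2 * β * d := by
      field_simp
    _ ≤ _ := by
      gcongr
      linarith [(Nat.cast_nonneg d : (0 : ℝ) ≤ d)]
end

section
/- Let d ≥ 1, let V : ℝ^d → ℝ be C¹ with Z_V := ∫ e^{−V} < ∞ and ⟨∇V(x), x⟩ ≥ a‖x‖² − b for all x (a > 0, b ≥ 0), and let p_t^V be the forward Ornstein–Uhlenbeck density started at μ = e^{−V}/Z_V. Then for all z ∈ ℝ^d and t > 0, ‖∇ log p_t^V(z)‖² ≤ (‖z‖²/(1−e^{−2t})²)(2 + e^{−2t}/(a(1−e^{−2t}))) + 2 e^{−2t}(2b + d)/(a(1−e^{−2t})²). -/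
open Real MeasureTheory
open scoped RealInnerProductSpace

/-- The forward Ornstein–Uhlenbeck density at time `t`, started at `μ = e^{-W}/∫ e^{-W}`:
`p_t(z) = (2π(1-e^{-2t}))^{-d/2} ∫ exp(-‖z - e^{-t}x‖²/(2(1-e^{-2t}))) μ(x) dx`. -/
noncomputable def ouDensity (d : ℕ) (W : EuclideanSpace ℝ (Fin d) → ℝ) (t : ℝ)
    (z : EuclideanSpace ℝ (Fin d)) : ℝ :=
  (2 * π * (1 - exp (-2 * t))) ^ (-(d : ℝ) / 2) *
    ∫ x : EuclideanSpace ℝ (Fin d),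
      exp (-‖z - exp (-t) • x‖ ^ 2 / (2 * (1 - exp (-2 * t)))) *
        (exp (-W x) / ∫ y : EuclideanSpace ℝ (Fin d), exp (-W y))

section SecondMoment

variable {E : Type*} [NormedAddCommGroup E] [InnerProductSpace ℝ E] [FiniteDimensional ℝ E]

/-- Along a ray, a dissipative potential grows at least quadratically up to a logarithm. -/
lemma dissipative_growth {U : E → ℝ} {G : E → E} (hU : ∀ x, HasGradientAt U (G x) x)
    {c B : ℝ} (hdiss : ∀ x, c * ‖x‖ ^ 2 - B ≤ ⟪G x, x⟫) (x : E) {r : ℝ} (hr : 1 ≤ r) :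
    U x + c * (r ^ 2 - 1) / 2 * ‖x‖ ^ 2 - B * log r ≤ U (r • x) := by
  have hderiv : ∀ s : ℝ, 0 < s → HasDerivAt
      (fun s : ℝ => U (s • x) - c * s ^ 2 / 2 * ‖x‖ ^ 2 + B * log s)
      (⟪G (s • x), x⟫ - c * s * ‖x‖ ^ 2 + B / s) s := by
    intro s hs
    have h1 : HasDerivAt (fun s : ℝ => s • x) x s := by
      simpa using (hasDerivAt_id s).smul_const x
    have h2 := (hU (s • x)).hasFDerivAt.comp_hasDerivAt s h1
    have h3 := (((hasDerivAt_pow 2 s).const_mul c).div_const 2).mul_const (‖x‖ ^ 2)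
    have h4 := (Real.hasDerivAt_log hs.ne').const_mul B
    refine ((h2.sub h3).add h4).congr_deriv ?_
    simp only [InnerProductSpace.toDual_apply_apply]
    push_cast
    ring
  have hmono : MonotoneOn (fun s : ℝ => U (s • x) - c * s ^ 2 / 2 * ‖x‖ ^ 2 + B * log s)
      (Set.Ici 1) := by
    refine monotoneOn_of_deriv_nonneg (convex_Ici 1)
      (fun s hs => (hderiv s (zero_lt_one.trans_le hs)).continuousAt.continuousWithinAt)
      (fun s hs => ?_) (fun s hs => ?_)
    all_goals
      rw [interior_Ici, Set.mem_Ioi] at hs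
      have hs0 : 0 < s := zero_lt_one.trans hs
    · exact (hderiv s hs0).differentiableAt.differentiableWithinAt
    · rw [(hderiv s hs0).deriv]
      have h := hdiss (s • x)
      rw [norm_smul, inner_smul_right, Real.norm_of_nonneg hs0.le] at h
      have : ⟪G (s • x), x⟫ - c * s * ‖x‖ ^ 2 + B / s
          = (s * ⟪G (s • x), x⟫ - (c * (s * ‖x‖) ^ 2 - B)) / s := by
        field_simp
        ring
      rw [this]
      exact div_nonneg (by linarith) hs0.le
  have h := hmono Set.self_mem_Ici (show r ∈ Set.Ici (1 : ℝ) from hr) hr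
  simp only [one_smul, Real.log_one] at h
  linarith

variable [MeasurableSpace E] [BorelSpace E]

/-- A scaling argument replacing integration by parts: the smoothed second moment of the Gibbs
weight of a dissipative potential. -/
lemma dissipative_integral_one_sub_exp_le {U : E → ℝ} {G : E → E}
    (hU : ∀ x, HasGradientAt U (G x) x) (hint : Integrable fun x => exp (-U x))
    {c B : ℝ} (hc : 0 < c) (hB : 0 ≤ B) (hdiss : ∀ x, c * ‖x‖ ^ 2 - B ≤ ⟪G x, x⟫)
    {ε : ℝ} (hε : 0 < ε) :
    Integrable (fun x => (1 - exp (-(ε * ‖x‖ ^ 2))) * exp (-U x)) ∧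
    ∫ x, (1 - exp (-(ε * ‖x‖ ^ 2))) * exp (-U x) ≤
      ε * ((Module.finrank ℝ E + B) / c * ∫ x, exp (-U x)) := by
  have hI0 : 0 ≤ ∫ x, exp (-U x) := integral_nonneg fun x => (exp_pos _).le
  set n := Module.finrank ℝ E
  set r : ℝ := √(1 + 2 * ε / c)
  have hr2 : r ^ 2 = 1 + 2 * ε / c := Real.sq_sqrt (by positivity)
  have hr1 : 1 ≤ r := Real.one_le_sqrt.2 (by
    have : 0 < 2 * ε / c := by positivity
    linarith)
  have hr0 : 0 < r := zero_lt_one.trans_le hr1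
  have hcr : c * (r ^ 2 - 1) / 2 = ε := by rw [hr2]; field_simp; ring
  have hint' : Integrable fun x => exp (-(ε * ‖x‖ ^ 2)) * exp (-U x) := by
    refine hint.bdd_mul (c := 1) (by fun_prop) (ae_of_all _ fun x => ?_)
    rw [Real.norm_of_nonneg (exp_pos _).le, Real.exp_le_one_iff]
    exact neg_nonpos.2 (by positivity)
  have hsub : Integrable (fun x => (1 - exp (-(ε * ‖x‖ ^ 2))) * exp (-U x)) := by
    simp only [sub_mul, one_mul]
    exact hint.sub hint'
  refine ⟨hsub, ?_⟩
  have hlog : log r ≤ ε / c := by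
    have h := Real.log_le_sub_one_of_pos (show 0 < r ^ 2 by positivity)
    rw [Real.log_pow, hr2] at h
    push_cast at h
    have : 2 * ε / c = 2 * (ε / c) := by ring
    linarith
  have hscale : ∫ x, exp (-U x) ≤
      exp ((n + B) * log r) * ∫ x, exp (-(ε * ‖x‖ ^ 2)) * exp (-U x) := by
    have h1 : ∫ x, exp (-U (r • x)) ≤
        ∫ x, exp (B * log r) * (exp (-(ε * ‖x‖ ^ 2)) * exp (-U x)) := by
      refine integral_mono (hint.comp_smul hr0.ne') (hint'.const_mul _) fun x => ?_
      have := dissipative_growth hU hdiss x hr1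
      rw [hcr] at this
      simp only [← Real.exp_add]
      exact Real.exp_le_exp.2 (by linarith)
    rw [Measure.integral_comp_smul volume (fun x => exp (-U x)), integral_const_mul,
      abs_of_nonneg (by positivity), smul_eq_mul, inv_mul_le_iff₀ (by positivity)] at h1
    refine h1.trans_eq ?_
    rw [add_mul, Real.exp_add, Real.exp_nat_mul, Real.exp_log hr0]
    ring
  have hdiff : ∫ x, (1 - exp (-(ε * ‖x‖ ^ 2))) * exp (-U x) =
      (∫ x, exp (-U x)) - ∫ x, exp (-(ε * ‖x‖ ^ 2)) * exp (-U x) := by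
    simp only [sub_mul, one_mul]
    exact integral_sub hint hint'
  rw [hdiff]
  have h2 : exp (-((n + B) * log r)) * ∫ x, exp (-U x) ≤
      ∫ x, exp (-(ε * ‖x‖ ^ 2)) * exp (-U x) := by
    rw [Real.exp_neg]
    exact (inv_mul_le_iff₀ (exp_pos _)).2 hscale
  have h3 : 1 - (n + B) * (ε / c) ≤ exp (-((n + B) * log r)) := by
    have h := Real.add_one_le_exp (-((n + B) * log r))
    have h' : (n + B) * log r ≤ (n + B) * (ε / c) := by gcongr
    linarith
  have h4 := mul_le_mul_of_nonneg_right h3 hI0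
  have h5 : ε * ((n + B) / c * ∫ x, exp (-U x)) = (n + B) * (ε / c) * ∫ x, exp (-U x) := by ring
  rw [h5]
  linarith

open Filter Topology in
/-- Second moment bound for the Gibbs weight of a dissipative potential. -/
lemma dissipative_second_moment {U : E → ℝ} {G : E → E}
    (hU : ∀ x, HasGradientAt U (G x) x) (hint : Integrable fun x => exp (-U x))
    {c B : ℝ} (hc : 0 < c) (hB : 0 ≤ B) (hdiss : ∀ x, c * ‖x‖ ^ 2 - B ≤ ⟪G x, x⟫) :
    Integrable (fun x => exp (-U x) * ‖x‖ ^ 2) ∧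
    ∫ x, exp (-U x) * ‖x‖ ^ 2 ≤ (Module.finrank ℝ E + B) / c * ∫ x, exp (-U x) := by
  set K := (Module.finrank ℝ E + B) / c * ∫ x, exp (-U x)
  have hK0 : 0 ≤ K := mul_nonneg (by positivity) (integral_nonneg fun x => (exp_pos _).le)
  have hUc : Continuous U := continuous_iff_continuousAt.2 fun x => (hU x).continuousAt
  let ε : ℕ → ℝ := fun n => 1 / (n + 1)
  have hε : ∀ n, 0 < ε n := fun n => Nat.one_div_pos_of_nat
  have hε0 : Tendsto ε atTop (𝓝[≠] 0) :=
    tendsto_nhdsWithin_iff.2 ⟨tendsto_one_div_add_atTop_nhds_zero_nat,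
      Eventually.of_forall fun n => (hε n).ne'⟩
  let F : ℕ → E → ℝ := fun n x => (ε n)⁻¹ * ((1 - exp (-(ε n * ‖x‖ ^ 2))) * exp (-U x))
  have hF0 : ∀ n x, 0 ≤ F n x := fun n x => by
    have : exp (-(ε n * ‖x‖ ^ 2)) ≤ 1 := Real.exp_le_one_iff.2
      (neg_nonpos.2 (mul_nonneg (hε n).le (by positivity)))
    exact mul_nonneg (inv_nonneg.2 (hε n).le) (mul_nonneg (by linarith) (exp_pos _).le)
  have hlim : ∀ x, Tendsto (fun n => F n x) atTop (𝓝 (exp (-U x) * ‖x‖ ^ 2)) := fun x => by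
    have h1 : HasDerivAt (fun s : ℝ => 1 - exp (-(s * ‖x‖ ^ 2))) (‖x‖ ^ 2) 0 := by
      have := (((hasDerivAt_id (0 : ℝ)).mul_const (‖x‖ ^ 2)).neg.exp).const_sub 1
      simpa using this
    have h2 := (h1.tendsto_slope_zero.comp hε0).mul_const (exp (-U x))
    rw [mul_comm (exp _)]
    refine h2.congr fun n => ?_
    simp [F, mul_assoc]
  have hle : ∫⁻ x, ENNReal.ofReal (exp (-U x) * ‖x‖ ^ 2) ≤ ENNReal.ofReal K := by
    have hl : ∀ x, liminf (fun n => ENNReal.ofReal (F n x)) atTop =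
        ENNReal.ofReal (exp (-U x) * ‖x‖ ^ 2) := fun x =>
      ((ENNReal.continuous_ofReal.tendsto _).comp (hlim x)).liminf_eq
    simp only [← hl]
    refine (lintegral_liminf_le fun n => by fun_prop).trans
      (liminf_le_of_le (by isBoundedDefault) fun y hy => ?_)
    obtain ⟨n, hn⟩ := hy.exists
    refine hn.trans ?_
    obtain ⟨hi, hb⟩ := dissipative_integral_one_sub_exp_le hU hint hc hB hdiss (hε n)
    rw [← ofReal_integral_eq_lintegral_ofReal (hi.const_mul _) (ae_of_all _ (hF0 n))]
    refine ENNReal.ofReal_le_ofReal ?_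
    rw [integral_const_mul]
    exact (inv_mul_le_iff₀ (hε n)).2 hb
  have hnn : ∀ x, 0 ≤ exp (-U x) * ‖x‖ ^ 2 := fun x => by positivity
  have hmeas : AEStronglyMeasurable (fun x => exp (-U x) * ‖x‖ ^ 2) volume := by fun_prop
  have hi : Integrable (fun x => exp (-U x) * ‖x‖ ^ 2) := by
    refine ⟨hmeas, ?_⟩
    rw [hasFiniteIntegral_iff_ofReal (ae_of_all _ hnn)]
    exact hle.trans_lt ENNReal.ofReal_lt_top
  refine ⟨hi, ?_⟩
  rw [← ofReal_integral_eq_lintegral_ofReal hi (ae_of_all _ hnn)] at hle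
  exact (ENNReal.ofReal_le_ofReal_iff hK0).1 hle

end SecondMoment

section GaussianSmoothing

variable {E : Type*} [NormedAddCommGroup E] [InnerProductSpace ℝ E] [FiniteDimensional ℝ E]
  [MeasurableSpace E] [BorelSpace E]

/-- Cauchy–Schwarz for a weighted Bochner integral. -/
lemma norm_integral_smul_sq_le {f : E → ℝ} {Y : E → E} (hf0 : ∀ x, 0 ≤ f x)
    (hf : Integrable f) (hpos : 0 < ∫ x, f x) (hfY : Integrable fun x => f x • Y x)
    (hfY2 : Integrable fun x => f x * ‖Y x‖ ^ 2) :
    ‖∫ x, f x • Y x‖ ^ 2 ≤ (∫ x, f x) * ∫ x, f x * ‖Y x‖ ^ 2 := by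
  set I := ∫ x, f x
  set v := ∫ x, f x • Y x with hv
  have h1 : I * ⟪v, v⟫ = ∫ x, f x * (I * ⟪v, Y x⟫) := by
    conv_lhs => rw [hv, ← integral_inner hfY, ← hv, ← integral_const_mul]
    refine integral_congr_ae (ae_of_all _ fun x => ?_)
    simp only [inner_smul_right]
    ring
  have hi : Integrable fun x => f x * (I * ⟪v, Y x⟫) := by
    refine ((hfY.const_inner v).const_mul I).congr (ae_of_all _ fun x => ?_)
    simp only [inner_smul_right]
    ring
  have h2 : ∫ x, f x * (I * ⟪v, Y x⟫) ≤
      ∫ x, (‖v‖ ^ 2 / 2 * f x + I ^ 2 / 2 * (f x * ‖Y x‖ ^ 2)) := by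
    refine integral_mono hi ((hf.const_mul _).add (hfY2.const_mul _)) fun x => ?_
    have hcs := mul_le_mul_of_nonneg_left (real_inner_le_norm v (Y x)) hpos.le
    have : I * ⟪v, Y x⟫ ≤ ‖v‖ ^ 2 / 2 + I ^ 2 / 2 * ‖Y x‖ ^ 2 := by
      nlinarith [sq_nonneg (‖v‖ - I * ‖Y x‖)]
    have := mul_le_mul_of_nonneg_left this (hf0 x)
    simp only
    linarith
  rw [integral_add (hf.const_mul _) (hfY2.const_mul _), integral_const_mul, integral_const_mul,
    ← h1, real_inner_self_eq_norm_sq] at h2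
  change I * ‖v‖ ^ 2 ≤ ‖v‖ ^ 2 / 2 * I + _ at h2
  refine le_of_mul_le_mul_left ?_ (half_pos hpos)
  linarith

lemma gaussian_weight_integrable {g : E → ℝ} (hg : Integrable g) (α : ℝ) {s : ℝ} (hs : 0 < s)
    (w : E) : Integrable fun x => exp (-‖w - α • x‖ ^ 2 / (2 * s)) * g x := by
  refine hg.bdd_mul (c := 1) (by fun_prop) (ae_of_all _ fun x => ?_)
  rw [Real.norm_of_nonneg (exp_pos _).le, Real.exp_le_one_iff, neg_div]
  exact neg_nonpos.2 (by positivity)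

lemma exp_neg_sq_mul_le {s : ℝ} (hs : 0 < s) (y : ℝ) :
    exp (-y ^ 2 / (2 * s)) * y ≤ 1 + s := by
  rw [neg_div, Real.exp_neg, inv_mul_le_iff₀ (exp_pos _)]
  have h := Real.add_one_le_exp (y ^ 2 / (2 * s))
  have h2 : y ≤ (y ^ 2 / (2 * s) + 1) * (1 + s) := by
    have : (y ^ 2 / (2 * s) + 1) * (1 + s) = y ^ 2 / (2 * s) + y ^ 2 / 2 + 1 + s := by
      field_simp
      ring
    rw [this]
    have : 0 ≤ y ^ 2 / (2 * s) := by positivity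
    nlinarith [sq_nonneg (y - 1)]
  exact h2.trans (by gcongr)

lemma gaussian_weight_smul_integrable {g : E → ℝ} (hg : Integrable g) (α : ℝ) {s : ℝ}
    (hs : 0 < s) (w : E) :
    Integrable fun x => (exp (-‖w - α • x‖ ^ 2 / (2 * s)) * g x) • (w - α • x) := by
  refine (hg.norm.const_mul (1 + s)).mono'
    ((gaussian_weight_integrable hg α hs w).aestronglyMeasurable.smul (by fun_prop))
    (ae_of_all _ fun x => ?_)
  rw [norm_smul, norm_mul, Real.norm_of_nonneg (exp_pos _).le, mul_right_comm]
  exact mul_le_mul_of_nonneg_right (exp_neg_sq_mul_le hs _) (norm_nonneg _)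

/-- Differentiation of a Gaussian smoothing under the integral sign. -/
lemma hasGradientAt_gaussian_smoothing {g : E → ℝ} (hg : Integrable g) (α : ℝ) {s : ℝ}
    (hs : 0 < s) (z : E) :
    HasGradientAt (fun w => ∫ x, exp (-‖w - α • x‖ ^ 2 / (2 * s)) * g x)
      (-(s⁻¹) • ∫ x, (exp (-‖z - α • x‖ ^ 2 / (2 * s)) * g x) • (z - α • x)) z := by
  have hpt : ∀ x w : E, HasFDerivAt (fun w => exp (-‖w - α • x‖ ^ 2 / (2 * s)) * g x)
      (InnerProductSpace.toDual ℝ E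
        (-(s⁻¹) • (exp (-‖w - α • x‖ ^ 2 / (2 * s)) * g x) • (w - α • x))) w := by
    intro x w
    have h1 := ((hasFDerivAt_id (𝕜 := ℝ) w).sub_const (α • x)).norm_sq
    have h2 := (((h1.neg.mul_const ((2 * s)⁻¹)).exp).mul_const (g x))
    simp only [← div_eq_mul_inv, id] at h2
    refine h2.congr_fderiv ?_
    ext y
    simp [InnerProductSpace.toDual_apply_apply]
    field_simp
  have hgrad_meas : ∀ w : E, AEStronglyMeasurable (fun x => InnerProductSpace.toDual ℝ E
        (-(s⁻¹) • (exp (-‖w - α • x‖ ^ 2 / (2 * s)) * g x) • (w - α • x))) volume := fun w =>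
    (InnerProductSpace.toDual ℝ E).continuous.comp_aestronglyMeasurable
      ((gaussian_weight_smul_integrable hg α hs w).aestronglyMeasurable.const_smul _)
  have h := hasFDerivAt_integral_of_dominated_of_fderiv_le (μ := volume) (𝕜 := ℝ)
    (F := fun w x => exp (-‖w - α • x‖ ^ 2 / (2 * s)) * g x) (x₀ := z) (s := Set.univ)
    (bound := fun x => s⁻¹ * ((1 + s) * ‖g x‖))
    Filter.univ_mem
    (Filter.Eventually.of_forall fun w =>
      (gaussian_weight_integrable hg α hs w).aestronglyMeasurable)
    (gaussian_weight_integrable hg α hs z) (hgrad_meas z)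
    (ae_of_all _ fun x w _ => by
      rw [LinearIsometryEquiv.norm_map, norm_smul, norm_neg, norm_inv,
        Real.norm_of_nonneg hs.le, norm_smul, norm_mul, Real.norm_of_nonneg (exp_pos _).le,
        mul_right_comm]
      gcongr
      exact exp_neg_sq_mul_le hs _)
    ((hg.norm.const_mul _).const_mul _)
    (ae_of_all _ fun x w _ => hpt x w)
  rw [hasGradientAt_iff_hasFDerivAt]
  refine h.congr_fderiv ?_
  rw [← integral_smul]
  exact (InnerProductSpace.toDual ℝ E).toLinearIsometry.toContinuousLinearMap.integral_comp_comm
    ((gaussian_weight_smul_integrable hg α hs z).smul (-(s⁻¹)))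

/-- Score bound for the Gaussian smoothing of the Gibbs weight of a dissipative potential. -/
lemma norm_gradient_log_gaussian_smoothing_sq_le {V : E → ℝ} {G : E → E}
    (hV : ∀ x, HasGradientAt V (G x) x) (hint : Integrable fun x => exp (-V x))
    {a b : ℝ} (ha : 0 < a) (hb : 0 ≤ b) (hdiss : ∀ x, a * ‖x‖ ^ 2 - b ≤ ⟪G x, x⟫)
    (α : ℝ) {s : ℝ} (hs : 0 < s) (z : E) :
    ‖gradient (fun w => log (∫ x, exp (-‖w - α • x‖ ^ 2 / (2 * s)) * exp (-V x))) z‖ ^ 2 ≤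
      (2 * ‖z‖ ^ 2 + 2 * α ^ 2 * ((Module.finrank ℝ E + (b + ‖z‖ ^ 2 / (4 * s))) / a)) / s ^ 2 := by
  set M := (Module.finrank ℝ E + (b + ‖z‖ ^ 2 / (4 * s))) / a
  let U : E → ℝ := fun x => V x + ‖z - α • x‖ ^ 2 / (2 * s)
  have hU : ∀ x, HasGradientAt U (G x - (α / s) • (z - α • x)) x := by
    intro x
    have h1 := (((hasFDerivAt_id (𝕜 := ℝ) x).const_smul α).const_sub z).norm_sq
    have h2 := (hV x).hasFDerivAt.add (h1.mul_const ((2 * s)⁻¹))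
    simp only [← div_eq_mul_inv, id, Pi.smul_apply] at h2
    rw [hasGradientAt_iff_hasFDerivAt]
    refine h2.congr_fderiv ?_
    ext y
    simp [InnerProductSpace.toDual_apply_apply]
    field_simp
    ring
  have hfU : ∀ x, exp (-‖z - α • x‖ ^ 2 / (2 * s)) * exp (-V x) = exp (-U x) := by
    intro x
    rw [← Real.exp_add]
    congr 1
    simp only [U]
    ring
  have hUint : Integrable fun x => exp (-U x) := by
    simpa only [hfU] using gaussian_weight_integrable hint α hs z
  have hUdiss : ∀ x, a * ‖x‖ ^ 2 - (b + ‖z‖ ^ 2 / (4 * s)) ≤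
      ⟪G x - (α / s) • (z - α • x), x⟫ := by
    intro x
    have h1 : ⟪G x - (α / s) • (z - α • x), x⟫ =
        ⟪G x, x⟫ + (α ^ 2 * ‖x‖ ^ 2 - α * ⟪z, x⟫) / s := by
      simp only [inner_sub_left, real_inner_smul_left, real_inner_self_eq_norm_sq]
      ring
    have h2 : 0 ≤ ‖z - (2 * α) • x‖ ^ 2 / (4 * s) := by positivity
    rw [norm_sub_sq_real, real_inner_smul_right, norm_smul, mul_pow, Real.norm_eq_abs,
      sq_abs] at h2
    have h3 : (‖z‖ ^ 2 - 2 * (2 * α * ⟪z, x⟫) + (2 * α) ^ 2 * ‖x‖ ^ 2) / (4 * s) =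
        ‖z‖ ^ 2 / (4 * s) + (α ^ 2 * ‖x‖ ^ 2 - α * ⟪z, x⟫) / s := by
      field_simp
      ring
    linarith [hdiss x]
  obtain ⟨hmi, hmle⟩ := dissipative_second_moment hU hUint ha (by positivity) hUdiss
  have hpos : 0 < ∫ x, exp (-U x) := integral_exp_pos hUint
  have hgrad := hasGradientAt_gaussian_smoothing hint α hs z
  have hYi := gaussian_weight_smul_integrable hint α hs z
  simp only [hfU] at hgrad hYi
  set I := ∫ x, exp (-U x) with hI
  set v := ∫ x, exp (-U x) • (z - α • x) with hv
  have hIz : ∫ x, exp (-‖z - α • x‖ ^ 2 / (2 * s)) * exp (-V x) = I := by simp only [hfU, hI]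
  have hlog : HasGradientAt
      (fun w => log (∫ x, exp (-‖w - α • x‖ ^ 2 / (2 * s)) * exp (-V x)))
      (I⁻¹ • (-(s⁻¹) • v)) z := by
    have h := hgrad.hasFDerivAt.log (by rw [hIz]; exact hpos.ne')
    rw [hIz] at h
    rw [hasGradientAt_iff_hasFDerivAt]
    simpa using h
  have hsq : ∀ x, ‖z - α • x‖ ^ 2 ≤ 2 * ‖z‖ ^ 2 + 2 * α ^ 2 * ‖x‖ ^ 2 := by
    intro x
    have h := parallelogram_law_with_norm ℝ z (α • x)
    have h' : ‖α • x‖ ^ 2 = α ^ 2 * ‖x‖ ^ 2 := by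
      rw [norm_smul, mul_pow, Real.norm_eq_abs, sq_abs]
    nlinarith [sq_nonneg ‖z + α • x‖]
  have hdom : Integrable fun x => 2 * ‖z‖ ^ 2 * exp (-U x) +
      2 * α ^ 2 * (exp (-U x) * ‖x‖ ^ 2) := (hUint.const_mul _).add (hmi.const_mul _)
  have hle : ∀ x, exp (-U x) * ‖z - α • x‖ ^ 2 ≤ 2 * ‖z‖ ^ 2 * exp (-U x) +
      2 * α ^ 2 * (exp (-U x) * ‖x‖ ^ 2) := fun x => by
    have := mul_le_mul_of_nonneg_left (hsq x) (exp_pos (-U x)).le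
    linarith
  have hY2i : Integrable fun x => exp (-U x) * ‖z - α • x‖ ^ 2 := by
    refine hdom.mono' (hUint.aestronglyMeasurable.mul (by fun_prop)) (ae_of_all _ fun x => ?_)
    rw [Real.norm_of_nonneg (by positivity)]
    exact hle x
  have hv2 : ‖v‖ ^ 2 ≤ I * ((2 * ‖z‖ ^ 2 + 2 * α ^ 2 * M) * I) := by
    refine (norm_integral_smul_sq_le (fun x => (exp_pos _).le) hUint hpos hYi hY2i).trans ?_
    refine mul_le_mul_of_nonneg_left ((integral_mono hY2i hdom hle).trans ?_) hpos.le
    rw [integral_add (hUint.const_mul _) (hmi.const_mul _), integral_const_mul,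
      integral_const_mul]
    have := mul_le_mul_of_nonneg_left hmle (show 0 ≤ 2 * α ^ 2 by positivity)
    linarith
  rw [hlog.gradient, norm_smul, norm_smul, norm_neg, norm_inv, norm_inv,
    Real.norm_of_nonneg hpos.le, Real.norm_of_nonneg hs.le, le_div_iff₀ (by positivity)]
  have h1 : (I⁻¹ * (s⁻¹ * ‖v‖)) ^ 2 * s ^ 2 = ‖v‖ ^ 2 / I ^ 2 := by
    field_simp
  rw [h1, div_le_iff₀ (by positivity)]
  linarith

end GaussianSmoothing

/-- If `V` is `C¹`, `∫ e^{-V} < ∞` and `μ = e^{-V}/Z_V` is `(a,b)`-dissipative,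
then the score of the forward OU density satisfies, for all `z` and `t > 0`,
`‖∇ log p_t^V(z)‖² ≤ (‖z‖²/(1-e^{-2t})²)(2 + e^{-2t}/(a(1-e^{-2t}))) + 2e^{-2t}(2b+d)/(a(1-e^{-2t})²)`. -/
theorem ou_score_bound
    (d : ℕ) (hd : 1 ≤ d) (V : EuclideanSpace ℝ (Fin d) → ℝ)
    (hV : ContDiff ℝ 1 V)
    (hint : Integrable fun x : EuclideanSpace ℝ (Fin d) => exp (-V x))
    (a b : ℝ) (ha : 0 < a) (hb : 0 ≤ b)
    (hdiss : ∀ x : EuclideanSpace ℝ (Fin d), a * ‖x‖ ^ 2 - b ≤ ⟪gradient V x, x⟫)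
    (z : EuclideanSpace ℝ (Fin d)) (t : ℝ) (ht : 0 < t) :
    ‖gradient (fun w => Real.log (ouDensity d V t w)) z‖ ^ 2 ≤
      ‖z‖ ^ 2 / (1 - exp (-2 * t)) ^ 2 * (2 + exp (-2 * t) / (a * (1 - exp (-2 * t)))) +
        2 * exp (-2 * t) * (2 * b + d) / (a * (1 - exp (-2 * t)) ^ 2) := by
  have hs : 0 < 1 - exp (-2 * t) := by
    have : exp (-2 * t) < 1 := Real.exp_lt_one_iff.2 (by linarith)
    linarith
  have hα : exp (-t) ^ 2 = exp (-2 * t) := by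
    rw [← Real.exp_nat_mul]
    congr 1
    push_cast
    ring
  have hVg : ∀ x, HasGradientAt V (gradient V x) x := fun x =>
    ((hV.differentiable one_ne_zero) x).hasGradientAt
  have hZ : 0 < ∫ y, exp (-V y) := integral_exp_pos hint
  have hlog : ∀ w, Real.log (ouDensity d V t w) =
      Real.log (∫ x, exp (-‖w - exp (-t) • x‖ ^ 2 / (2 * (1 - exp (-2 * t)))) * exp (-V x)) +
        Real.log ((2 * π * (1 - exp (-2 * t))) ^ (-(d : ℝ) / 2) / ∫ y, exp (-V y)) := by
    intro w
    have hI : 0 < ∫ x, exp (-‖w - exp (-t) • x‖ ^ 2 / (2 * (1 - exp (-2 * t)))) * exp (-V x) := by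
      have hi := gaussian_weight_integrable hint (exp (-t)) hs w
      simp only [← Real.exp_add] at hi ⊢
      exact integral_exp_pos hi
    have hC : 0 < (2 * π * (1 - exp (-2 * t))) ^ (-(d : ℝ) / 2) := by positivity
    rw [← Real.log_mul hI.ne' (div_pos hC hZ).ne', ouDensity]
    simp only [← mul_div_assoc]
    rw [integral_div]
    congr 1
    ring
  have hgrad : gradient (fun w => Real.log (ouDensity d V t w)) z =
      gradient (fun w => Real.log
        (∫ x, exp (-‖w - exp (-t) • x‖ ^ 2 / (2 * (1 - exp (-2 * t)))) * exp (-V x))) z := by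
    simp only [hlog, gradient, fderiv_add_const]
  rw [hgrad]
  refine (norm_gradient_log_gaussian_smoothing_sq_le hVg hint ha hb hdiss
    (exp (-t)) hs z).trans ?_
  rw [hα, finrank_euclideanSpace_fin]
  set s := 1 - exp (-2 * t)
  set q := exp (-2 * t)
  have hq0 : 0 < q := exp_pos _
  have hgap : ‖z‖ ^ 2 / s ^ 2 * (2 + q / (a * s)) + 2 * q * (2 * b + d) / (a * s ^ 2) -
      (2 * ‖z‖ ^ 2 + 2 * q * ((d + (b + ‖z‖ ^ 2 / (4 * s))) / a)) / s ^ 2 =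
      q * ‖z‖ ^ 2 / (2 * a * s ^ 3) + 2 * q * b / (a * s ^ 2) := by
    field_simp
    ring
  have : 0 ≤ q * ‖z‖ ^ 2 / (2 * a * s ^ 3) + 2 * q * b / (a * s ^ 2) := by positivity
  linarith
end

section
/- Let d ≥ 1, let V : ℝ^d → ℝ be C¹ with Z_V := ∫ e^{−V} < ∞ and ⟨∇V(x), x⟩ ≥ a‖x‖² − b for all x (a > 0, b ≥ 0), and let p_t^V be the forward Ornstein–Uhlenbeck density started at μ = e^{−V}/Z_V. Then for all z ∈ ℝ^d and t > 0, the Laplacian of log p_t^V satisfies Δ log p_t^V(z) ≤ (e^{−2t}/(1−e^{−2t})²) (‖z‖²/(2a(1−e^{−2t})) + (2b + d)/a). -/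
open Real MeasureTheory
open scoped RealInnerProductSpace

section Moments

variable {E : Type*} [NormedAddCommGroup E] [InnerProductSpace ℝ E]

theorem add_le_apply_smul_of_dissipative {U : E → ℝ} (hU : Differentiable ℝ U) {a B : ℝ}
    (hdiss : ∀ x, a * ‖x‖ ^ 2 - B ≤ fderiv ℝ U x x) {l : ℝ} (hl : 1 ≤ l) (x : E) :
    U x + a * ‖x‖ ^ 2 * ((l ^ 2 - 1) / 2) - B * log l ≤ U (l • x) := by
  have hder : ∀ s : ℝ, 0 < s →
      HasDerivAt (fun s : ℝ => U (s • x) - a * ‖x‖ ^ 2 * (s ^ 2 / 2) + B * log s)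
        (fderiv ℝ U (s • x) x - a * ‖x‖ ^ 2 * s + B * s⁻¹) s := by
    intro s hs
    have h₁ : HasDerivAt (fun s : ℝ => U (s • x)) (fderiv ℝ U (s • x) x) s := by
      have := (hU (s • x)).hasFDerivAt.comp_hasDerivAt s ((hasDerivAt_id s).smul_const x)
      simpa [Function.comp_def] using this
    have h₂ : HasDerivAt (fun s : ℝ => a * ‖x‖ ^ 2 * (s ^ 2 / 2)) (a * ‖x‖ ^ 2 * s) s := by
      refine (((hasDerivAt_pow 2 s).div_const 2).const_mul (a * ‖x‖ ^ 2)).congr_deriv ?_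
      norm_num
    exact (h₁.sub h₂).add ((hasDerivAt_log hs.ne').const_mul B)
  have hmono : MonotoneOn (fun s : ℝ => U (s • x) - a * ‖x‖ ^ 2 * (s ^ 2 / 2) + B * log s)
      (Set.Ici 1) := by
    refine monotoneOn_of_hasDerivWithinAt_nonneg
      (f' := fun s => fderiv ℝ U (s • x) x - a * ‖x‖ ^ 2 * s + B * s⁻¹) (convex_Ici 1)
      (fun s hs => (hder s (zero_lt_one.trans_le hs)).continuousAt.continuousWithinAt) ?_ ?_
    · intro s hs
      rw [interior_Ici] at hs
      exact (hder s (zero_lt_one.trans hs)).hasDerivWithinAt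
    · intro s hs
      rw [interior_Ici] at hs
      have hs : 0 < s := zero_lt_one.trans hs
      have h := hdiss (s • x)
      rw [map_smul, norm_smul, norm_of_nonneg hs.le, smul_eq_mul] at h
      have : fderiv ℝ U (s • x) x - a * ‖x‖ ^ 2 * s + B * s⁻¹ =
          s⁻¹ * (s * fderiv ℝ U (s • x) x - (a * (s * ‖x‖) ^ 2 - B)) := by
        field_simp
        ring
      rw [this]
      exact mul_nonneg (inv_nonneg.2 hs.le) (sub_nonneg.2 h)
  have h := hmono Set.self_mem_Ici (Set.mem_Ici.2 hl) hl
  simp only [one_smul, log_one] at h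
  linarith

theorem exp_neg_le_quadratic {y : ℝ} (hy : 0 ≤ y) : exp (-y) ≤ 1 - y + y ^ 2 / 2 := by
  have h := quadratic_le_exp_of_nonneg hy
  have hpos : 0 < 1 + y + y ^ 2 / 2 := by positivity
  rw [exp_neg]
  calc (exp y)⁻¹ ≤ (1 + y + y ^ 2 / 2)⁻¹ := inv_anti₀ hpos h
    _ ≤ 1 - y + y ^ 2 / 2 := by
      rw [inv_le_iff_one_le_mul₀ hpos]
      nlinarith [sq_nonneg (y ^ 2)]

variable [FiniteDimensional ℝ E] [MeasurableSpace E] [BorelSpace E]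

theorem second_moment_le_of_dissipative {U : E → ℝ} (hU : Differentiable ℝ U) {a B : ℝ}
    (ha : 0 ≤ a) (hB : 0 ≤ B) (hdiss : ∀ x, a * ‖x‖ ^ 2 - B ≤ fderiv ℝ U x x)
    (h₀ : Integrable fun x => exp (-U x)) (h₂ : Integrable fun x => ‖x‖ ^ 2 * exp (-U x))
    (h₄ : Integrable fun x => ‖x‖ ^ 4 * exp (-U x)) :
    a * ∫ x, ‖x‖ ^ 2 * exp (-U x) ≤ (Module.finrank ℝ E + B) * ∫ x, exp (-U x) := by
  set Z := ∫ x, exp (-U x)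
  set J₂ := ∫ x, ‖x‖ ^ 2 * exp (-U x)
  set J₄ := ∫ x, ‖x‖ ^ 4 * exp (-U x)
  set n := Module.finrank ℝ E
  have hZ : 0 ≤ Z := integral_nonneg fun x => (exp_pos _).le
  have key : ∀ ε : ℝ, 0 < ε → a * J₂ ≤ (n + B) * Z + ε * (a ^ 2 / 2 * J₄) := by
    intro ε hε
    set l := √(1 + 2 * ε)
    have hl2 : l ^ 2 = 1 + 2 * ε := sq_sqrt (by positivity)
    have hl : 1 ≤ l := one_le_sqrt.2 (by linarith)
    have hl0 : 0 < l := zero_lt_one.trans_le hl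
    have hlog : log l ≤ ε := by
      rw [log_sqrt (by positivity)]
      linarith [log_le_sub_one_of_pos (show 0 < 1 + 2 * ε by positivity)]
    have hpt : ∀ x, exp (-(B * log l)) * exp (-U (l • x)) ≤
        exp (-U x) - ε * a * (‖x‖ ^ 2 * exp (-U x)) +
          ε ^ 2 * a ^ 2 / 2 * (‖x‖ ^ 4 * exp (-U x)) := by
      intro x
      have h := add_le_apply_smul_of_dissipative hU hdiss hl x
      rw [hl2] at h
      calc exp (-(B * log l)) * exp (-U (l • x))
          ≤ exp (-(ε * a * ‖x‖ ^ 2)) * exp (-U x) := by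
            rw [← exp_add, ← exp_add]
            exact exp_le_exp.2 (by linarith)
        _ ≤ (1 - ε * a * ‖x‖ ^ 2 + (ε * a * ‖x‖ ^ 2) ^ 2 / 2) * exp (-U x) := by
            gcongr
            exact exp_neg_le_quadratic (by positivity)
        _ = _ := by ring
    have hscale : ∫ x, exp (-U (l • x)) = exp (-(n * log l)) * Z := by
      rw [Measure.integral_comp_smul volume (fun x => exp (-U x)) l, smul_eq_mul,
        abs_of_nonneg (by positivity), exp_neg, exp_nat_mul, exp_log hl0]
    have hint : Integrable fun x => exp (-U (l • x)) := h₀.comp_smul hl0.ne'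
    have hI := integral_mono (hint.const_mul (exp (-(B * log l))))
      ((h₀.sub (h₂.const_mul (ε * a))).add (h₄.const_mul (ε ^ 2 * a ^ 2 / 2))) hpt
    have hsplit : ∫ x, (exp (-U x) - ε * a * (‖x‖ ^ 2 * exp (-U x)) +
        ε ^ 2 * a ^ 2 / 2 * (‖x‖ ^ 4 * exp (-U x))) =
        Z - ε * a * J₂ + ε ^ 2 * a ^ 2 / 2 * J₄ := by
      have h₂' := h₂.const_mul (ε * a)
      have h₄' := h₄.const_mul (ε ^ 2 * a ^ 2 / 2)
      rw [integral_add (by exact h₀.sub h₂') h₄', integral_sub h₀ h₂', integral_const_mul,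
        integral_const_mul]
    have hI' : exp (-(B * log l)) * (exp (-(n * log l)) * Z) ≤
        Z - ε * a * J₂ + ε ^ 2 * a ^ 2 / 2 * J₄ := by
      rw [← hsplit, ← hscale, ← integral_const_mul]
      exact hI
    have hlow : (1 - (n + B) * ε) * Z ≤ exp (-(B * log l)) * (exp (-(n * log l)) * Z) := by
      rw [← mul_assoc, ← exp_add]
      gcongr
      have h₁ := add_one_le_exp (-(B * log l) + -(n * log l))
      have h₂ : (n + B) * log l ≤ (n + B) * ε := by gcongr
      linarith
    refine le_of_mul_le_mul_left (?_ : ε * _ ≤ ε * _) hε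
    linarith
  refine ge_of_tendsto (x := nhdsWithin (0 : ℝ) (Set.Ioi 0)) (f := fun ε : ℝ =>
    (n + B) * Z + ε * (a ^ 2 / 2 * J₄)) ?_ (eventually_mem_nhdsWithin.mono key)
  have : Continuous fun ε : ℝ => (n + B) * Z + ε * (a ^ 2 / 2 * J₄) := by fun_prop
  simpa using (this.tendsto 0).mono_left nhdsWithin_le_nhds

end Moments

section ExponentialTilt

variable {E F : Type*} [NormedAddCommGroup E] [InnerProductSpace ℝ E]
  [MeasurableSpace E] [BorelSpace E] [NormedAddCommGroup F] [NormedSpace ℝ F]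

theorem MeasureTheory.Integrable.exp_inner_smul {φ : E → F} {ν : Measure E}
    (hφ : ∀ c : ℝ, Integrable (fun x => exp (c * ‖x‖) • φ x) ν) (w : E) (k : ℝ) :
    Integrable (fun x => exp ⟪w, k • x⟫ • φ x) ν := by
  have hm : AEStronglyMeasurable φ ν := by simpa using (hφ 0).aestronglyMeasurable
  refine (hφ (‖w‖ * |k|)).norm.mono'
    (AEStronglyMeasurable.smul (Continuous.aestronglyMeasurable (by fun_prop)) hm)
    (.of_forall fun x => ?_)
  rw [norm_smul, norm_smul, norm_of_nonneg (exp_pos _).le, norm_of_nonneg (exp_pos _).le]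
  gcongr
  refine (real_inner_le_norm _ _).trans_eq ?_
  rw [norm_smul, norm_eq_abs, mul_assoc]

variable [SecondCountableTopology E]

theorem MeasureTheory.Integrable.exp_norm_smul_smulRight {φ : E → F} {ν : Measure E}
    (hφ : ∀ c : ℝ, Integrable (fun x => exp (c * ‖x‖) • φ x) ν) (k c : ℝ) :
    Integrable (fun x => exp (c * ‖x‖) • (innerSL ℝ (k • x)).smulRight (φ x)) ν := by
  have hm : AEStronglyMeasurable φ ν := by simpa using (hφ 0).aestronglyMeasurable
  refine ((hφ (c + 1)).norm.const_mul |k|).mono' ?_ (.of_forall fun x => ?_)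
  · refine AEStronglyMeasurable.fun_smul (Continuous.aestronglyMeasurable (by fun_prop)) ?_
    have hc : Continuous fun p : E × F => (innerSL ℝ (k • p.1)).smulRight p.2 := by fun_prop
    exact hc.comp_aestronglyMeasurable (aestronglyMeasurable_id.prodMk hm)
  · rw [norm_smul, norm_smul, ContinuousLinearMap.norm_smulRight_apply, innerSL_apply_norm,
      norm_smul, norm_of_nonneg (exp_pos _).le, norm_of_nonneg (exp_pos _).le, add_mul, exp_add,
      norm_eq_abs, one_mul]
    have : ‖x‖ ≤ exp ‖x‖ := by linarith [add_one_le_exp ‖x‖]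
    calc exp (c * ‖x‖) * (|k| * ‖x‖ * ‖φ x‖) = |k| * (exp (c * ‖x‖) * ‖x‖ * ‖φ x‖) := by ring
      _ ≤ _ := by gcongr

theorem hasFDerivAt_integral_exp_inner_smul {φ : E → F} {ν : Measure E}
    (hφ : ∀ c : ℝ, Integrable (fun x => exp (c * ‖x‖) • φ x) ν) (k : ℝ) (z : E) :
    HasFDerivAt (fun w => ∫ x, exp ⟪w, k • x⟫ • φ x ∂ν)
      (∫ x, exp ⟪z, k • x⟫ • (innerSL ℝ (k • x)).smulRight (φ x) ∂ν) z := by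
  have hφ' := Integrable.exp_norm_smul_smulRight hφ k
  refine hasFDerivAt_integral_of_dominated_of_fderiv_le
    (bound := fun x => ‖exp ((‖z‖ + 1) * |k| * ‖x‖) • (innerSL ℝ (k • x)).smulRight (φ x)‖)
    (F' := fun w x => exp ⟪w, k • x⟫ • (innerSL ℝ (k • x)).smulRight (φ x))
    (Metric.ball_mem_nhds z one_pos)
    (.of_forall fun w => (Integrable.exp_inner_smul hφ w k).aestronglyMeasurable)
    (Integrable.exp_inner_smul hφ z k) (Integrable.exp_inner_smul hφ' z k).aestronglyMeasurable
    (.of_forall fun x w hw => ?_) (hφ' _).norm (.of_forall fun x w _ => ?_)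
  · rw [norm_smul, norm_smul, norm_of_nonneg (exp_pos _).le, norm_of_nonneg (exp_pos _).le]
    gcongr
    refine (real_inner_le_norm _ _).trans ?_
    rw [norm_smul, norm_eq_abs, mul_assoc]
    gcongr
    rw [mem_ball_iff_norm] at hw
    linarith [norm_le_norm_add_norm_sub' w z]
  · have h : HasFDerivAt (fun w : E => exp ⟪w, k • x⟫) (exp ⟪w, k • x⟫ • innerSL ℝ (k • x)) w := by
      have := (innerSL ℝ (k • x)).hasFDerivAt (x := w) |>.exp
      simp only [innerSL_apply_apply] at this
      simpa only [real_inner_comm] using this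
    convert h.smul_const (φ x) using 1
    ext u
    simp [mul_smul]

end ExponentialTilt

theorem iteratedFDeriv_two_log_add_quadratic_le {E : Type*} [NormedAddCommGroup E]
    [InnerProductSpace ℝ E] {N : E → ℝ} {N' : E → E →L[ℝ] ℝ} {N'' : E →L[ℝ] E →L[ℝ] ℝ} {z : E}
    (hpos : ∀ w, 0 < N w) (hN : ∀ w, HasFDerivAt N (N' w) w) (hN' : HasFDerivAt N' N'' z)
    {q : ℝ} (hq : 0 ≤ q) (c : ℝ) (v : E) :
    iteratedFDeriv ℝ 2 (fun w => c - q * ‖w‖ ^ 2 + log (N w)) z ![v, v] ≤ N'' v v / N z := by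
  have h₁ : fderiv ℝ (fun w => c - q * ‖w‖ ^ 2 + log (N w)) =
      fun w => (N w)⁻¹ • N' w - (2 * q) • innerSL ℝ w := by
    funext w
    have h := (((hasStrictFDerivAt_norm_sq w).hasFDerivAt.const_mul q).const_sub c).add
      ((hN w).log (hpos w).ne')
    refine (h.congr_fderiv ?_).fderiv
    ext u
    simp
    ring
  let I : E →L[ℝ] E →L[ℝ] ℝ := innerSL ℝ
  have h₂ : HasFDerivAt (fun w => (N w)⁻¹ • N' w - (2 * q) • innerSL ℝ w)
      ((N z)⁻¹ • N'' + (-(N z ^ 2)⁻¹ • N' z).smulRight (N' z) - (2 * q) • I) z :=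
    (((hasDerivAt_inv (hpos z).ne').comp_hasFDerivAt z (hN z)).smul hN').sub
      (I.hasFDerivAt.const_smul (2 * q))
  rw [iteratedFDeriv_two_apply, h₁, h₂.fderiv]
  have h₃ : 0 ≤ (N z ^ 2)⁻¹ * (N' z v) ^ 2 := by positivity
  have h₄ : 0 ≤ 2 * q * ‖v‖ ^ 2 := by positivity
  have h₅ : I v v = ‖v‖ ^ 2 := real_inner_self_eq_norm_sq v
  simp [h₅]
  rw [div_eq_inv_mul]
  linarith

theorem MeasureTheory.Integrable.exp_norm_smul_gaussian_mul {E : Type*} [NormedAddCommGroup E]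
    [MeasurableSpace E] [BorelSpace E] [SecondCountableTopology E] {ν : Measure E} {g : E → ℝ}
    (hg : Integrable g ν) {q : ℝ} (hq : 0 < q) (c : ℝ) :
    Integrable (fun x => exp (c * ‖x‖) • (exp (-(q * ‖x‖ ^ 2)) * g x)) ν := by
  have hm := hg.aestronglyMeasurable
  refine (hg.norm.const_mul (exp (c ^ 2 / (4 * q)))).mono' (by fun_prop) (.of_forall fun x => ?_)
  rw [norm_smul, norm_mul, norm_of_nonneg (exp_pos _).le, norm_of_nonneg (exp_pos _).le,
    ← mul_assoc, ← exp_add]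
  gcongr
  rw [le_div_iff₀ (by positivity)]
  nlinarith [sq_nonneg (c - 2 * q * ‖x‖)]

theorem MeasureTheory.Integrable.norm_pow_mul_of_exp_norm_smul {E : Type*} [NormedAddCommGroup E]
    [MeasurableSpace E] [BorelSpace E] [SecondCountableTopology E] {ν : Measure E} {g : E → ℝ}
    (hg : ∀ c : ℝ, Integrable (fun x => exp (c * ‖x‖) • g x) ν) (n : ℕ) :
    Integrable (fun x => ‖x‖ ^ n * g x) ν := by
  have hm : AEStronglyMeasurable g ν := by simpa using (hg 0).aestronglyMeasurable
  refine (hg n).norm.mono' (by fun_prop) (.of_forall fun x => ?_)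
  rw [norm_smul, norm_mul, norm_pow, norm_norm, norm_of_nonneg (exp_pos _).le, exp_nat_mul]
  gcongr
  linarith [add_one_le_exp ‖x‖]

theorem MeasureTheory.Integrable.exp_norm_smul_exp_inner_mul {E : Type*} [NormedAddCommGroup E]
    [InnerProductSpace ℝ E] [MeasurableSpace E] [BorelSpace E] [SecondCountableTopology E]
    {ν : Measure E} {g : E → ℝ}
    (hg : ∀ c : ℝ, Integrable (fun x => exp (c * ‖x‖) • g x) ν) (z : E) (k c : ℝ) :
    Integrable (fun x => exp (c * ‖x‖) • (exp ⟪z, k • x⟫ * g x)) ν := by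
  have hm : AEStronglyMeasurable g ν := by simpa using (hg 0).aestronglyMeasurable
  refine (hg (c + ‖z‖ * |k|)).norm.mono' (by fun_prop) (.of_forall fun x => ?_)
  rw [norm_smul, norm_smul, norm_mul, norm_of_nonneg (exp_pos _).le,
    norm_of_nonneg (exp_pos _).le, norm_of_nonneg (exp_pos _).le, add_mul, exp_add, ← mul_assoc]
  gcongr
  refine (real_inner_le_norm _ _).trans_eq ?_
  rw [norm_smul, norm_eq_abs, mul_assoc]

/-- The unnormalised Laplace transform whose logarithm differs from `log p_t` by a quadratic. -/
noncomputable def tiltedMass {E : Type*} [NormedAddCommGroup E] [InnerProductSpace ℝ E]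
    [MeasureSpace E] (V : E → ℝ) (q k : ℝ) (w : E) : ℝ :=
  ∫ x, exp ⟪w, k • x⟫ • (exp (-(q * ‖x‖ ^ 2)) * exp (-V x))

theorem tiltedMass_pos {E : Type*} [NormedAddCommGroup E] [InnerProductSpace ℝ E]
    [FiniteDimensional ℝ E] [MeasurableSpace E] [BorelSpace E] {V : E → ℝ}
    (hint : Integrable fun x => exp (-V x)) {q : ℝ} (hq : 0 < q) (k : ℝ) (w : E) :
    0 < tiltedMass V q k w := by
  have h := Integrable.exp_inner_smul (hint.exp_norm_smul_gaussian_mul hq) w k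
  simp only [smul_eq_mul, ← exp_add] at h
  simpa only [tiltedMass, smul_eq_mul, ← exp_add] using integral_exp_pos h

theorem log_ouDensity (d : ℕ) {V : EuclideanSpace ℝ (Fin d) → ℝ}
    (hint : Integrable fun x : EuclideanSpace ℝ (Fin d) => exp (-V x)) {t : ℝ} (ht : 0 < t) :
    ∃ c : ℝ, ∀ w, log (ouDensity d V t w) = c - 1 / (2 * (1 - exp (-2 * t))) * ‖w‖ ^ 2 +
      log (tiltedMass V (exp (-2 * t) / (2 * (1 - exp (-2 * t))))
        (exp (-t) / (1 - exp (-2 * t))) w) := by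
  have hs : 0 < 1 - exp (-2 * t) := sub_pos.2 (exp_lt_one_iff.2 (by linarith))
  have hα : exp (-2 * t) = exp (-t) ^ 2 := by rw [← exp_nat_mul]; ring_nf
  set s := 1 - exp (-2 * t) with hsdef
  have hZ : 0 < ∫ y : EuclideanSpace ℝ (Fin d), exp (-V y) := integral_exp_pos hint
  set Z := ∫ y : EuclideanSpace ℝ (Fin d), exp (-V y)
  have hC : 0 < (2 * π * s) ^ (-(d : ℝ) / 2) / Z := by positivity
  refine ⟨log ((2 * π * s) ^ (-(d : ℝ) / 2) / Z), fun w => ?_⟩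
  have hM := tiltedMass_pos hint (show 0 < exp (-2 * t) / (2 * s) by positivity)
    (exp (-t) / s) w
  have hfac : ouDensity d V t w = (2 * π * s) ^ (-(d : ℝ) / 2) / Z *
      (exp (-(1 / (2 * s) * ‖w‖ ^ 2)) * tiltedMass V (exp (-2 * t) / (2 * s)) (exp (-t) / s) w) := by
    rw [ouDensity, ← hsdef, tiltedMass, div_mul_eq_mul_div, mul_div_assoc,
      ← integral_const_mul (exp (-(1 / (2 * s) * ‖w‖ ^ 2))), ← integral_div]
    congr 2
    funext x
    rw [← mul_div_assoc, smul_eq_mul, ← exp_add, ← exp_add, ← exp_add, ← exp_add]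
    congr 2
    rw [norm_sub_sq_real, inner_smul_right, inner_smul_right, norm_smul,
      norm_of_nonneg (exp_pos _).le, hα]
    field_simp
    ring
  rw [hfac, log_mul hC.ne' (by positivity), log_mul (exp_pos _).ne' hM.ne', log_exp]
  ring

theorem sum_iteratedFDeriv_two_log_tiltedMass_le {d : ℕ} {V : EuclideanSpace ℝ (Fin d) → ℝ}
    (hint : Integrable fun x : EuclideanSpace ℝ (Fin d) => exp (-V x)) {q : ℝ} (hq : 0 < q)
    (k : ℝ) {r : ℝ} (hr : 0 ≤ r) (c : ℝ) (z : EuclideanSpace ℝ (Fin d)) :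
    ∑ i : Fin d, iteratedFDeriv ℝ 2 (fun w => c - r * ‖w‖ ^ 2 + log (tiltedMass V q k w)) z
        ![EuclideanSpace.single i 1, EuclideanSpace.single i 1] ≤
      k ^ 2 * (∫ x, ‖x‖ ^ 2 * (exp ⟪z, k • x⟫ * (exp (-(q * ‖x‖ ^ 2)) * exp (-V x)))) /
        tiltedMass V q k z := by
  have h₀ := hint.exp_norm_smul_gaussian_mul hq
  have h₁ := Integrable.exp_norm_smul_smulRight h₀ k
  have h₂ := Integrable.exp_inner_smul (Integrable.exp_norm_smul_smulRight h₁ k) z k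
  refine (Finset.sum_le_sum fun i _ => iteratedFDeriv_two_log_add_quadratic_le
    (tiltedMass_pos hint hq k) (hasFDerivAt_integral_exp_inner_smul h₀ k)
    (hasFDerivAt_integral_exp_inner_smul h₁ k z) hr c _).trans_eq ?_
  have h₃ (v : EuclideanSpace ℝ (Fin d)) := h₂.apply_continuousLinearMap v
  rw [← Finset.sum_div]
  congr 1
  simp only [ContinuousLinearMap.integral_apply h₂, ContinuousLinearMap.integral_apply (h₃ _)]
  rw [← integral_finsetSum _ fun i _ => (h₃ _).apply_continuousLinearMap _,
    ← integral_const_mul]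
  congr 1
  funext x
  simp only [_root_.smul_apply, ContinuousLinearMap.smulRight_apply,
    innerSL_apply_apply, EuclideanSpace.inner_single_right, smul_eq_mul]
  generalize exp (-(q * ‖x‖ ^ 2)) * exp (-V x) = g
  rw [EuclideanSpace.norm_sq_eq, Finset.sum_mul, Finset.mul_sum]
  refine Finset.sum_congr rfl fun i _ => ?_
  simp
  ring

theorem second_moment_tilted_le {E : Type*} [NormedAddCommGroup E] [InnerProductSpace ℝ E]
    [FiniteDimensional ℝ E] [MeasurableSpace E] [BorelSpace E] {V : E → ℝ}
    (hV : Differentiable ℝ V) (hint : Integrable fun x => exp (-V x)) {a b : ℝ} (ha : 0 < a)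
    (hb : 0 ≤ b) (hdiss : ∀ x, a * ‖x‖ ^ 2 - b ≤ fderiv ℝ V x x) {q : ℝ} (hq : 0 < q) (k : ℝ)
    (z : E) :
    a * (∫ x, ‖x‖ ^ 2 * (exp ⟪z, k • x⟫ * (exp (-(q * ‖x‖ ^ 2)) * exp (-V x)))) ≤
      (Module.finrank ℝ E + (b + k ^ 2 * ‖z‖ ^ 2 / (8 * q))) * tiltedMass V q k z := by
  have h := Integrable.exp_norm_smul_exp_inner_mul (hint.exp_norm_smul_gaussian_mul hq) z k
  have hU (x : E) : exp ⟪z, k • x⟫ * (exp (-(q * ‖x‖ ^ 2)) * exp (-V x)) =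
      exp (-(q * ‖x‖ ^ 2 + V x - innerSL ℝ (k • z) x)) := by
    rw [← exp_add, ← exp_add, innerSL_apply_apply, inner_smul_right, inner_smul_left]
    simp only [conj_trivial]
    ring_nf
  have h₀ := Integrable.norm_pow_mul_of_exp_norm_smul h 0
  have h₂ := Integrable.norm_pow_mul_of_exp_norm_smul h 2
  have h₄ := Integrable.norm_pow_mul_of_exp_norm_smul h 4
  simp only [hU, pow_zero, one_mul] at h₀ h₂ h₄
  simp only [tiltedMass, smul_eq_mul, hU]
  have hd (x : E) : HasFDerivAt (fun x : E => q * ‖x‖ ^ 2 + V x - innerSL ℝ (k • z) x)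
      (q • (2 • innerSL ℝ x) + fderiv ℝ V x - innerSL ℝ (k • z)) x :=
    (((hasStrictFDerivAt_norm_sq x).hasFDerivAt.const_mul q).add (hV x).hasFDerivAt).sub
      (innerSL ℝ (k • z)).hasFDerivAt
  refine second_moment_le_of_dissipative (fun x => (hd x).differentiableAt) ha.le (by positivity)
    (fun x => ?_) h₀ h₂ h₄
  rw [(hd x).fderiv]
  have hx : (q • (2 • innerSL ℝ x) + fderiv ℝ V x - innerSL ℝ (k • z)) x =
      q * (2 * ‖x‖ ^ 2) + fderiv ℝ V x x - ⟪k • z, x⟫ := by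
    simp [inner_smul_left]
  have hin : ⟪k • z, x⟫ ≤ |k| * ‖z‖ * ‖x‖ := by
    simpa [norm_smul] using real_inner_le_norm (k • z) x
  have hyoung : |k| * ‖z‖ * ‖x‖ ≤ q * (2 * ‖x‖ ^ 2) + k ^ 2 * ‖z‖ ^ 2 / (8 * q) := by
    have : q * (2 * ‖x‖ ^ 2) + k ^ 2 * ‖z‖ ^ 2 / (8 * q) - |k| * ‖z‖ * ‖x‖ =
        (4 * q * ‖x‖ - |k| * ‖z‖) ^ 2 / (8 * q) := by
      rw [← sq_abs k]
      field_simp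
      ring
    linarith [show 0 ≤ (4 * q * ‖x‖ - |k| * ‖z‖) ^ 2 / (8 * q) by positivity]
  rw [hx]
  linarith [hdiss x]

/-- Under `(a,b)`-dissipativity of `μ = e^{-V}/Z_V`, the Laplacian (trace of
the Hessian, computed in the standard orthonormal basis) of `log p_t^V` satisfies, for all `z`
and `t > 0`, `Δ log p_t^V(z) ≤ (e^{-2t}/(1-e^{-2t})²)(‖z‖²/(2a(1-e^{-2t})) + (2b+d)/a)`. -/
theorem ou_log_laplacian_bound
    (d : ℕ) (hd : 1 ≤ d) (V : EuclideanSpace ℝ (Fin d) → ℝ)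
    (hV : ContDiff ℝ 1 V)
    (hint : Integrable fun x : EuclideanSpace ℝ (Fin d) => exp (-V x))
    (a b : ℝ) (ha : 0 < a) (hb : 0 ≤ b)
    (hdiss : ∀ x : EuclideanSpace ℝ (Fin d), a * ‖x‖ ^ 2 - b ≤ ⟪gradient V x, x⟫)
    (z : EuclideanSpace ℝ (Fin d)) (t : ℝ) (ht : 0 < t) :
    (∑ i : Fin d, iteratedFDeriv ℝ 2 (fun w => Real.log (ouDensity d V t w)) z
        ![EuclideanSpace.single i 1, EuclideanSpace.single i 1]) ≤
      exp (-2 * t) / (1 - exp (-2 * t)) ^ 2 *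
        (‖z‖ ^ 2 / (2 * a * (1 - exp (-2 * t))) + (2 * b + d) / a) := by
  have hs : 0 < 1 - exp (-2 * t) := sub_pos.2 (exp_lt_one_iff.2 (by linarith))
  have hα : exp (-t) ^ 2 = exp (-2 * t) := by rw [← exp_nat_mul]; ring_nf
  obtain ⟨c, hc⟩ := log_ouDensity d hint ht
  simp only [hc]
  set s := 1 - exp (-2 * t)
  have hq : 0 < exp (-2 * t) / (2 * s) := by positivity
  have hM := tiltedMass_pos hint hq (exp (-t) / s) z
  have hV' : Differentiable ℝ V := hV.differentiable one_ne_zero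
  have hmoment := second_moment_tilted_le hV' hint ha hb
    (fun x => by simpa [gradient] using hdiss x) hq (exp (-t) / s) z
  refine (sum_iteratedFDeriv_two_log_tiltedMass_le hint hq (exp (-t) / s)
    (show 0 ≤ 1 / (2 * s) by positivity) c z).trans ?_
  rw [mul_div_assoc, div_pow, hα]
  gcongr
  rw [div_le_iff₀ hM]
  refine le_of_mul_le_mul_left (hmoment.trans ?_) ha
  rw [← mul_assoc]
  gcongr
  rw [finrank_euclideanSpace_fin, div_pow, hα]
  have h₁ : exp (-2 * t) / s ^ 2 * ‖z‖ ^ 2 / (8 * (exp (-2 * t) / (2 * s))) =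
      ‖z‖ ^ 2 / (4 * s) := by
    field_simp
    ring
  have h₂ : a * (‖z‖ ^ 2 / (2 * a * s) + (2 * b + d) / a) =
      2 * (‖z‖ ^ 2 / (4 * s)) + (2 * b + d) := by
    field_simp
    ring
  rw [h₁, h₂]
  linarith [show 0 ≤ ‖z‖ ^ 2 / (4 * s) by positivity]
end

section
/- Let d ≥ 1 and let V : ℝ^d → ℝ be C² with Z_V := ∫ e^{−V} < ∞ and ∇²V(x) ⪯ β I_d for all x, with β > 0. Then the probability density μ(x) = e^{−V(x)}/Z_V satisfies μ(x) ≤ (β/(2π))^{d/2} for every x ∈ ℝ^d. -/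
open Real MeasureTheory
open scoped RealInnerProductSpace

/-- If the Hessian of `V` is at most `β`, then the second symmetric difference of `V` satisfies the
corresponding quadratic upper bound. -/
theorem add_apply_sub_le_of_hessian_le {E : Type*} [NormedAddCommGroup E] [NormedSpace ℝ E]
    {V : E → ℝ} (hV : ContDiff ℝ 2 V) {β : ℝ}
    (hhess : ∀ x v : E, iteratedFDeriv ℝ 2 V x ![v, v] ≤ β * ‖v‖ ^ 2) (x v : E) :
    V (x + v) + V (x - v) ≤ 2 * V x + β * ‖v‖ ^ 2 := by
  have hline (t : ℝ) : HasDerivAt (fun s : ℝ => x + s • v) v t := by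
    simpa using ((hasDerivAt_id t).smul_const v).const_add x
  have h1 (t : ℝ) : HasDerivAt (fun s : ℝ => V (x + s • v)) (fderiv ℝ V (x + t • v) v) t :=
    ((hV.differentiable (by norm_num)) _).hasFDerivAt.comp_hasDerivAt t (hline t)
  have h2 (t : ℝ) : HasDerivAt (fun s : ℝ => fderiv ℝ V (x + s • v) v)
      (fderiv ℝ (fderiv ℝ V) (x + t • v) v v) t := by
    have hd : Differentiable ℝ (fderiv ℝ V) :=
      (hV.fderiv_right (m := 1) (by norm_num)).differentiable (by norm_num)
    simpa using ((hd _).hasFDerivAt.comp_hasDerivAt t (hline t)).clm_apply (hasDerivAt_const t v)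
  have hf (t : ℝ) : HasDerivAt (fun s : ℝ => β * ‖v‖ ^ 2 / 2 * s ^ 2 - V (x + s • v))
      (β * ‖v‖ ^ 2 * t - fderiv ℝ V (x + t • v) v) t := by
    refine (((hasDerivAt_pow 2 t).const_mul (β * ‖v‖ ^ 2 / 2)).sub (h1 t)).congr_deriv ?_
    norm_num
    ring
  have hf' (t : ℝ) : HasDerivAt (fun s : ℝ => β * ‖v‖ ^ 2 * s - fderiv ℝ V (x + s • v) v)
      (β * ‖v‖ ^ 2 - fderiv ℝ (fderiv ℝ V) (x + t • v) v v) t := by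
    exact (((hasDerivAt_id t).const_mul (β * ‖v‖ ^ 2)).sub (h2 t)).congr_deriv (by simp)
  have hconv : ConvexOn ℝ Set.univ (fun s : ℝ => β * ‖v‖ ^ 2 / 2 * s ^ 2 - V (x + s • v)) := by
    refine convexOn_of_hasDerivWithinAt2_nonneg convex_univ
      (fun t _ => (hf t).continuousAt.continuousWithinAt)
      (fun t _ => (hf t).hasDerivWithinAt) (fun t _ => (hf' t).hasDerivWithinAt) fun t _ => ?_
    have := hhess (x + t • v) v
    rw [iteratedFDeriv_two_apply] at this
    simpa using this
  have := hconv.2 (Set.mem_univ (-1)) (Set.mem_univ 1) one_half_pos.le one_half_pos.le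
    (add_halves 1)
  norm_num [← sub_eq_add_neg] at this
  linarith

/-- If `V : ℝ^d → ℝ` is `C²` with `∫ e^{-V} < ∞` and `∇²V ⪯ β I_d`
(`β > 0`), then the density `μ = e^{-V}/Z_V` is bounded by `(β/(2π))^{d/2}` everywhere. -/
theorem semi_log_convex_density_max_bound
    (d : ℕ) (hd : 1 ≤ d) (V : EuclideanSpace ℝ (Fin d) → ℝ)
    (hV : ContDiff ℝ 2 V)
    (hint : Integrable fun x : EuclideanSpace ℝ (Fin d) => exp (-V x))
    (β : ℝ) (hβ : 0 < β)
    (hhess : ∀ x v : EuclideanSpace ℝ (Fin d),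
      iteratedFDeriv ℝ 2 V x ![v, v] ≤ β * ‖v‖ ^ 2) :
    ∀ x : EuclideanSpace ℝ (Fin d),
      exp (-V x) / (∫ y : EuclideanSpace ℝ (Fin d), exp (-V y)) ≤
        (β / (2 * π)) ^ ((d : ℝ) / 2) := by
  intro x
  have hplus : Integrable fun y : EuclideanSpace ℝ (Fin d) => exp (-V (x + y)) :=
    hint.comp_add_left x
  have hminus : Integrable fun y : EuclideanSpace ℝ (Fin d) => exp (-V (x - y)) :=
    hint.comp_sub_left x
  have hgauss : ∫ y : EuclideanSpace ℝ (Fin d), exp (-(β / 2) * ‖y‖ ^ 2) =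
      (2 * π / β) ^ ((d : ℝ) / 2) := by
    rw [GaussianFourier.integral_rexp_neg_mul_sq_norm (half_pos hβ), finrank_euclideanSpace_fin]
    congr 1
    field_simp
  have hpoint (y : EuclideanSpace ℝ (Fin d)) :
      2 * exp (-V x) * exp (-(β / 2) * ‖y‖ ^ 2) ≤ exp (-V (x + y)) + exp (-V (x - y)) := by
    have hV2 := add_apply_sub_le_of_hessian_le hV hhess x y
    set a := -V (x + y) with ha
    set b := -V (x - y) with hb
    calc 2 * exp (-V x) * exp (-(β / 2) * ‖y‖ ^ 2)
        = 2 * exp (-V x + -(β / 2) * ‖y‖ ^ 2) := by rw [exp_add]; ring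
      _ ≤ 2 * exp (a / 2 + b / 2) :=
        mul_le_mul_of_nonneg_left (exp_le_exp.2 (by linarith)) zero_le_two
      _ = 2 * exp (a / 2) * exp (b / 2) := by rw [exp_add]; ring
      _ ≤ exp (a / 2) ^ 2 + exp (b / 2) ^ 2 := two_mul_le_add_sq _ _
      _ = exp a + exp b := by simp [← exp_nat_mul, mul_div_cancel₀]
  have hlower : exp (-V x) * (2 * π / β) ^ ((d : ℝ) / 2) ≤
      ∫ y : EuclideanSpace ℝ (Fin d), exp (-V y) := by
    have hmono := integral_mono_of_nonneg (.of_forall fun y => by positivity)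
      (hplus.add hminus) (.of_forall hpoint)
    simp only [Pi.add_apply] at hmono
    rw [integral_const_mul, hgauss, integral_add hplus hminus,
      integral_add_left_eq_self (fun y => exp (-V y)),
      integral_sub_left_eq_self (fun y => exp (-V y))] at hmono
    linarith
  have hpos : 0 < (2 * π / β) ^ ((d : ℝ) / 2) := by positivity
  have hZ : 0 < ∫ y : EuclideanSpace ℝ (Fin d), exp (-V y) :=
    (by positivity : 0 < exp (-V x) * (2 * π / β) ^ ((d : ℝ) / 2)).trans_le hlower
  rw [← inv_div (2 * π) β, inv_rpow (by positivity), div_le_iff₀ hZ, ← div_eq_inv_mul,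
    le_div_iff₀ hpos]
  exact hlower
end

section
/- Let d ≥ 1, let V : ℝ^d → ℝ be C² with Z_V := ∫ e^{−V} < ∞ and ∇²V(x) ⪯ β I_d for all x (β ≥ 0), and let p_t^V be the forward Ornstein–Uhlenbeck density started at μ = e^{−V}/Z_V. Then for all z ∈ ℝ^d and t > 0, −I_d − ∇² log p_t^V(z) ⪯ ((β−1)e^{−2t}/((1−e^{−2t})(β−1) + 1)) I_d, where −I_d is the Hessian of the log-density of the standard Gaussian. -/
open Real MeasureTheory
open scoped RealInnerProductSpace

open Set in
/-- A `C²` function whose Hessian is at most `β` is `β/2 ‖x‖²` minus a convex function. -/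
lemma convexOn_half_mul_sq_norm_sub {E : Type*} [NormedAddCommGroup E] [InnerProductSpace ℝ E]
    {V : E → ℝ} (hV : ContDiff ℝ 2 V) {β : ℝ}
    (hhess : ∀ x v : E, iteratedFDeriv ℝ 2 V x ![v, v] ≤ β * ‖v‖ ^ 2) :
    ConvexOn ℝ univ fun x => β / 2 * ‖x‖ ^ 2 - V x := by
  have hline : ∀ x v : E,
      ConvexOn ℝ univ fun τ : ℝ => β / 2 * ‖x + τ • v‖ ^ 2 - V (x + τ • v) := by
    intro x v
    have hl : ∀ τ : ℝ, HasDerivAt (fun τ : ℝ => x + τ • v) v τ := fun τ => by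
      simpa using ((hasDerivAt_id τ).smul_const v).const_add x
    have hd1 : ∀ τ : ℝ, HasDerivAt (fun τ : ℝ => β / 2 * ‖x + τ • v‖ ^ 2 - V (x + τ • v))
        (β * inner ℝ (x + τ • v) v - fderiv ℝ V (x + τ • v) v) τ := by
      intro τ
      have h1 := ((hl τ).norm_sq).const_mul (β / 2)
      have h2 : HasDerivAt (fun τ : ℝ => V (x + τ • v)) (fderiv ℝ V (x + τ • v) v) τ :=
        (hV.differentiable (by norm_num) (x + τ • v)).hasFDerivAt.comp_hasDerivAt τ (hl τ)
      exact (h1.sub h2).congr_deriv (by ring)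
    have hd2 : ∀ τ : ℝ, HasDerivAt
        (fun τ : ℝ => β * inner ℝ (x + τ • v) v - fderiv ℝ V (x + τ • v) v)
        (β * ‖v‖ ^ 2 - iteratedFDeriv ℝ 2 V (x + τ • v) ![v, v]) τ := by
      intro τ
      have h1 := ((hl τ).inner ℝ (hasDerivAt_const τ v)).const_mul β
      have hVd : Differentiable ℝ (fderiv ℝ V) :=
        (hV.fderiv_right (m := 1) (by norm_num)).differentiable (by norm_num)
      have h2 : HasDerivAt (fun τ : ℝ => fderiv ℝ V (x + τ • v))
          (fderiv ℝ (fderiv ℝ V) (x + τ • v) v) τ :=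
        (hVd (x + τ • v)).hasFDerivAt.comp_hasDerivAt τ (hl τ)
      exact (h1.sub (h2.clm_apply (hasDerivAt_const τ v))).congr_deriv
        (by simp [iteratedFDeriv_two_apply])
    exact convexOn_of_hasDerivWithinAt2_nonneg convex_univ
      (fun τ _ => (hd1 τ).continuousAt.continuousWithinAt)
      (fun τ _ => (hd1 τ).hasDerivWithinAt) (fun τ _ => (hd2 τ).hasDerivWithinAt)
      (fun τ _ => sub_nonneg.2 (hhess _ _))
  refine ⟨convex_univ, fun x _ y _ a b ha hb hab => ?_⟩
  have h := (hline x (y - x)).2 (mem_univ 0) (mem_univ 1) ha hb hab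
  have hxy : x + (a • (0 : ℝ) + b • (1 : ℝ)) • (y - x) = a • x + b • y := by
    rw [← eq_sub_iff_add_eq] at hab
    subst hab
    simp only [smul_eq_mul, mul_zero, mul_one, zero_add]
    module
  simpa only [hxy, zero_smul, add_zero, one_smul, add_sub_cancel] using h

open Set in
/-- An integral of log-convex functions is log-convex. -/
lemma convexOn_log_integral_exp {E Ω : Type*} [AddCommGroup E] [Module ℝ E] [MeasurableSpace Ω]
    {μ : Measure Ω} [NeZero μ] {f : E → Ω → ℝ} (hf : ∀ y, ConvexOn ℝ univ fun x => f x y)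
    (hint : ∀ x, Integrable (fun y => exp (f x y)) μ) :
    ConvexOn ℝ univ fun x => log (∫ y, exp (f x y) ∂μ) := by
  refine ⟨convex_univ, fun x _ w _ a b ha hb hab => ?_⟩
  have hx := integral_exp_pos (hint x)
  have hw := integral_exp_pos (hint w)
  have hxw := integral_exp_pos (hint (a • x + b • w))
  set A := ∫ y, exp (f x y) ∂μ
  set B := ∫ y, exp (f w y) ∂μ
  have hpt : ∀ y, exp (f (a • x + b • w) y) ≤
      exp (a * log A + b * log B) * (a / A * exp (f x y) + b / B * exp (f w y)) := by
    intro y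
    have h1 := (hf y).2 (mem_univ x) (mem_univ w) ha hb hab
    have h2 := convexOn_exp.2 (mem_univ (f x y - log A)) (mem_univ (f w y - log B)) ha hb hab
    simp only [smul_eq_mul, exp_sub, exp_log hx, exp_log hw] at h1 h2
    calc exp (f (a • x + b • w) y)
        ≤ exp ((a * log A + b * log B) + (a * (f x y - log A) + b * (f w y - log B))) :=
          exp_le_exp.2 (by linarith)
      _ ≤ exp (a * log A + b * log B) * (a * (exp (f x y) / A) + b * (exp (f w y) / B)) := by
          rw [exp_add]; gcongr
      _ = _ := by ring
  rw [smul_eq_mul, smul_eq_mul, log_le_iff_le_exp hxw]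
  have hX : Integrable (fun y => a / A * exp (f x y)) μ := (hint x).const_mul _
  have hW : Integrable (fun y => b / B * exp (f w y)) μ := (hint w).const_mul _
  refine (integral_mono (hint _) ((hX.add hW).const_mul _) hpt).trans_eq ?_
  simp only [Pi.add_apply]
  rw [integral_const_mul, integral_add hX hW, integral_const_mul, integral_const_mul,
    div_mul_cancel₀ _ hx.ne', div_mul_cancel₀ _ hw.ne', hab, mul_one]

open Set in
/-- If `f + c/2 ‖·‖²` is convex, the Hessian of `f` is at least `-c`. No second order
differentiability is needed, since otherwise `iteratedFDeriv ℝ 2 f z` vanishes. -/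
lemma neg_mul_sq_norm_le_iteratedFDeriv_two {E : Type*} [NormedAddCommGroup E]
    [InnerProductSpace ℝ E] {f : E → ℝ} (hf : Differentiable ℝ f) {c : ℝ} (hc : 0 ≤ c)
    (hconv : ConvexOn ℝ univ fun w => f w + c / 2 * ‖w‖ ^ 2) (z v : E) :
    -(c * ‖v‖ ^ 2) ≤ iteratedFDeriv ℝ 2 f z ![v, v] := by
  rw [iteratedFDeriv_two_apply]
  by_cases h2 : DifferentiableAt ℝ (fderiv ℝ f) z
  · have hl : ∀ τ : ℝ, HasDerivAt (fun τ : ℝ => z + τ • v) v τ := fun τ => by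
      simpa using ((hasDerivAt_id τ).smul_const v).const_add z
    have hd1 : ∀ τ : ℝ, HasDerivAt (fun τ : ℝ => f (z + τ • v) + c / 2 * ‖z + τ • v‖ ^ 2)
        (fderiv ℝ f (z + τ • v) v + c * inner ℝ (z + τ • v) v) τ := by
      intro τ
      have h1 : HasDerivAt (fun τ : ℝ => f (z + τ • v)) (fderiv ℝ f (z + τ • v) v) τ :=
        (hf (z + τ • v)).hasFDerivAt.comp_hasDerivAt τ (hl τ)
      exact (h1.add (((hl τ).norm_sq).const_mul (c / 2))).congr_deriv (by ring)
    have hd2 : HasDerivAt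
        (fun τ : ℝ => fderiv ℝ f (z + τ • v) v + c * inner ℝ (z + τ • v) v)
        (fderiv ℝ (fderiv ℝ f) z v v + c * ‖v‖ ^ 2) 0 := by
      have h2' : HasFDerivAt (fderiv ℝ f) (fderiv ℝ (fderiv ℝ f) z) (z + (0 : ℝ) • v) := by
        simpa using h2.hasFDerivAt
      have h3 : HasDerivAt (fun τ : ℝ => fderiv ℝ f (z + τ • v))
          (fderiv ℝ (fderiv ℝ f) z v) 0 := h2'.comp_hasDerivAt (0 : ℝ) (hl 0)
      exact ((h3.clm_apply (hasDerivAt_const (0 : ℝ) v)).add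
        (((hl 0).inner ℝ (hasDerivAt_const (0 : ℝ) v)).const_mul c)).congr_deriv (by simp)
    have hcl : ConvexOn ℝ univ (fun τ : ℝ => f (z + τ • v) + c / 2 * ‖z + τ • v‖ ^ 2) := by
      refine ⟨convex_univ, fun x _ y _ a b ha hb hab => ?_⟩
      have h := hconv.2 (mem_univ (z + x • v)) (mem_univ (z + y • v)) ha hb hab
      have he : a • (z + x • v) + b • (z + y • v) = z + (a • x + b • y) • v := by
        rw [← eq_sub_iff_add_eq] at hab
        subst hab
        simp only [smul_eq_mul]
        module
      simpa only [he] using h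
    have hmono := hcl.monotoneOn_deriv fun τ _ => (hd1 τ).differentiableAt
    rw [monotoneOn_univ, funext fun τ => (hd1 τ).deriv] at hmono
    have h0 := hmono.deriv_nonneg (x := 0)
    rw [hd2.deriv] at h0
    simp only [Matrix.cons_val_zero, Matrix.cons_val_one]
    linarith
  · rw [fderiv_zero_of_not_differentiableAt h2]
    simp only [zero_apply, Left.neg_nonpos_iff]
    positivity

section GaussianKernel

variable {E : Type*} [NormedAddCommGroup E] [InnerProductSpace ℝ E] [MeasurableSpace E]
  [BorelSpace E] {μ : Measure E} {g : E → ℝ}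

lemma integrable_gaussian_mul (hg : Integrable g μ) (a : ℝ) {s : ℝ} (hs : 0 < s) (z : E) :
    Integrable (fun x => exp (-‖z - a • x‖ ^ 2 / (2 * s)) * g x) μ := by
  refine hg.bdd_mul (c := 1) (Continuous.aestronglyMeasurable (by fun_prop)) ?_
  refine Filter.Eventually.of_forall fun x => ?_
  rw [norm_of_nonneg (exp_pos _).le, exp_le_one_iff, neg_div, Left.neg_nonpos_iff]
  positivity

/-- Gaussian smoothing of an integrable function is differentiable. -/
lemma differentiable_integral_gaussian_mul [SecondCountableTopology E] (hg : Integrable g μ)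
    (a : ℝ) {s : ℝ} (hs : 0 < s) :
    Differentiable ℝ fun z => ∫ x, exp (-‖z - a • x‖ ^ 2 / (2 * s)) * g x ∂μ := by
  intro z
  have hder : ∀ x w : E, HasFDerivAt (fun w => exp (-‖w - a • x‖ ^ 2 / (2 * s)) * g x)
      ((g x * exp (-‖w - a • x‖ ^ 2 / (2 * s)) * (-(1 / s))) • innerSL ℝ (w - a • x)) w := by
    intro x w
    have h1 : HasFDerivAt (fun w : E => ‖w - a • x‖ ^ 2) (2 • innerSL ℝ (w - a • x)) w := by
      simpa using ((hasFDerivAt_id w).sub_const (a • x)).norm_sq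
    have h2 := (((h1.neg).mul_const (2 * s)⁻¹).exp).mul_const (g x)
    simp only [← div_eq_mul_inv] at h2
    refine h2.congr_fderiv ?_
    ext u
    simp
    ring
  refine (hasFDerivAt_integral_of_dominated_of_fderiv_le (𝕜 := ℝ) (s := Set.univ)
    (bound := fun x => (1 / (2 * s) + 1) * ‖g x‖)
    (F' := fun w x => (g x * exp (-‖w - a • x‖ ^ 2 / (2 * s)) * (-(1 / s))) •
      innerSL ℝ (w - a • x)) Filter.univ_mem
    (Filter.Eventually.of_forall fun w => (integrable_gaussian_mul hg a hs w).1)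
    (integrable_gaussian_mul hg a hs z) ?_ ?_ (hg.norm.const_mul _)
    (Filter.Eventually.of_forall fun x w _ => hder x w)).differentiableAt
  · refine AEStronglyMeasurable.smul ((hg.1.mul ?_).mul_const _) ?_
    · exact Continuous.aestronglyMeasurable (by fun_prop)
    · exact Continuous.aestronglyMeasurable (by fun_prop)
  · refine Filter.Eventually.of_forall fun x w _ => ?_
    rw [norm_smul, innerSL_apply_norm, norm_mul, norm_mul, norm_neg,
      norm_of_nonneg (exp_pos _).le, norm_of_nonneg (by positivity : 0 ≤ 1 / s)]
    set r := ‖w - a • x‖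
    have hr : exp (-r ^ 2 / (2 * s)) * (1 + r ^ 2 / (2 * s)) ≤ 1 := by
      calc exp (-r ^ 2 / (2 * s)) * (1 + r ^ 2 / (2 * s))
          ≤ exp (-r ^ 2 / (2 * s)) * exp (r ^ 2 / (2 * s)) := by
            gcongr; linarith [add_one_le_exp (r ^ 2 / (2 * s))]
        _ = 1 := by rw [← exp_add, neg_div, neg_add_cancel, exp_zero]
    have hr' : 1 / s * r ≤ (1 / (2 * s) + 1) * (1 + r ^ 2 / (2 * s)) := by
      have h1 : 1 / s * r ≤ 1 / (2 * s) + r ^ 2 / (2 * s) := by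
        rw [← add_div, one_div_mul_eq_div, div_le_div_iff₀ hs (by positivity)]
        nlinarith [mul_nonneg hs.le (sq_nonneg (r - 1))]
      have h2 : 0 ≤ 1 / (2 * s) * (r ^ 2 / (2 * s)) := by positivity
      linarith
    calc ‖g x‖ * exp (-r ^ 2 / (2 * s)) * (1 / s) * r
        = ‖g x‖ * exp (-r ^ 2 / (2 * s)) * (1 / s * r) := by ring
      _ ≤ ‖g x‖ * exp (-r ^ 2 / (2 * s)) * ((1 / (2 * s) + 1) * (1 + r ^ 2 / (2 * s))) := by
        gcongr
      _ = (1 / (2 * s) + 1) * ‖g x‖ * (exp (-r ^ 2 / (2 * s)) * (1 + r ^ 2 / (2 * s))) := by ring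
      _ ≤ (1 / (2 * s) + 1) * ‖g x‖ := mul_le_of_le_one_right (by positivity) hr

end GaussianKernel

open Set in
/-- Gaussian smoothing of `e^{-V}`, where `V` is `β/2 ‖x‖²` minus a convex function, yields
`e^{-c/2 ‖z‖²}` times a log-convex function, with `c = β / (s β + a²)`. -/
lemma convexOn_log_integral_gaussian_mul {E : Type*} [NormedAddCommGroup E]
    [InnerProductSpace ℝ E] [MeasurableSpace E] [BorelSpace E]
    {μ : Measure E} [NeZero μ] [μ.IsAddRightInvariant] {V : E → ℝ}
    (hint : Integrable (fun x => exp (-V x)) μ) {β : ℝ}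
    (hV : ConvexOn ℝ univ fun x => β / 2 * ‖x‖ ^ 2 - V x) {a s : ℝ} (hs : 0 < s)
    (hD : 0 < s * β + a ^ 2) :
    ConvexOn ℝ univ fun z => log (∫ x, exp (-‖z - a • x‖ ^ 2 / (2 * s)) * exp (-V x) ∂μ) +
      β / (s * β + a ^ 2) / 2 * ‖z‖ ^ 2 := by
  set D := s * β + a ^ 2 with hDdef
  set f : E → E → ℝ := fun z y => -‖z - a • (y + (a / D) • z)‖ ^ 2 / (2 * s)
    + -V (y + (a / D) • z) + β / D / 2 * ‖z‖ ^ 2 with hf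
  have hfexp : ∀ z, (fun y => exp (f z y)) = fun y =>
      (fun x => exp (-‖z - a • x‖ ^ 2 / (2 * s)) * exp (-V x) * exp (β / D / 2 * ‖z‖ ^ 2))
        (y + (a / D) • z) := by
    intro z
    ext y
    simp only [hf, exp_add]
  have hfint : ∀ z, Integrable (fun y => exp (f z y)) μ := by
    intro z
    rw [hfexp]
    exact ((integrable_gaussian_mul hint a hs z).mul_const _).comp_add_right _
  have hfsq : ∀ z y, f z y = (β / 2 * ‖(a / D) • z + y‖ ^ 2 - V ((a / D) • z + y))
      + -(D / (2 * s)) * ‖y‖ ^ 2 := by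
    intro z y
    have h1 : ‖z - a • (y + (a / D) • z)‖ ^ 2 =
        (1 - a ^ 2 / D) ^ 2 * ‖z‖ ^ 2 - 2 * ((1 - a ^ 2 / D) * a) * inner ℝ z y
          + a ^ 2 * ‖y‖ ^ 2 := by
      have : z - a • (y + (a / D) • z) = (1 - a ^ 2 / D) • z - a • y := by
        rw [show a ^ 2 / D = a * (a / D) by ring]; module
      rw [this, norm_sub_sq_real, norm_smul, norm_smul, inner_smul_left, inner_smul_right,
        mul_pow, mul_pow, norm_eq_abs, norm_eq_abs, sq_abs, sq_abs]
      simp only [conj_trivial]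
      ring
    have h2 : ‖(a / D) • z + y‖ ^ 2 =
        (a / D) ^ 2 * ‖z‖ ^ 2 + 2 * (a / D) * inner ℝ z y + ‖y‖ ^ 2 := by
      rw [norm_add_sq_real, norm_smul, inner_smul_left, mul_pow, norm_eq_abs, sq_abs]
      simp only [conj_trivial]
      ring
    simp only [hf]
    rw [h1, add_comm y, h2]
    have hβ : β = (D - a ^ 2) / s := by rw [hDdef]; field_simp; ring
    have hD0 := hD.ne'
    have hs0 := hs.ne'
    clear_value D
    subst hβ
    field_simp
    ring
  have hfconv : ∀ y, ConvexOn ℝ univ fun z => f z y := by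
    intro y
    simp only [hfsq]
    refine ConvexOn.add_const ⟨convex_univ, fun x _ w _ p q hp hq hpq => ?_⟩ _
    have h := hV.2 (mem_univ ((a / D) • x + y)) (mem_univ ((a / D) • w + y)) hp hq hpq
    have he : p • ((a / D) • x + y) + q • ((a / D) • w + y) = (a / D) • (p • x + q • w) + y := by
      rw [← eq_sub_iff_add_eq] at hpq
      subst hpq
      module
    simpa only [he] using h
  convert convexOn_log_integral_exp hfconv hfint using 2 with z
  rw [hfexp, integral_add_right_eq_self (μ := μ)
    (fun x => exp (-‖z - a • x‖ ^ 2 / (2 * s)) * exp (-V x) * exp (β / D / 2 * ‖z‖ ^ 2)),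
    integral_mul_const, log_mul _ (exp_pos _).ne', log_exp]
  have h := integrable_gaussian_mul hint a hs z
  simp only [← exp_add] at h ⊢
  exact (integral_exp_pos h).ne'

/-- If `μ = e^{-V}/Z_V` is `β`-semi-log-convex, then for all `z`, `t > 0` and
every direction `v`, the Hessian of `log p_t^V` satisfies the matrix inequality
`-I_d - ∇² log p_t^V(z) ⪯ ((β-1)e^{-2t}/((1-e^{-2t})(β-1)+1)) I_d`, expressed through
quadratic forms (`-I_d` being the Hessian of the log-density of the standard Gaussian). -/
theorem ou_log_hessian_lower_bound
    (d : ℕ) (hd : 1 ≤ d) (V : EuclideanSpace ℝ (Fin d) → ℝ)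
    (hV : ContDiff ℝ 2 V)
    (hint : Integrable fun x : EuclideanSpace ℝ (Fin d) => exp (-V x))
    (β : ℝ) (hβ : 0 ≤ β)
    (hhess : ∀ x v : EuclideanSpace ℝ (Fin d),
      iteratedFDeriv ℝ 2 V x ![v, v] ≤ β * ‖v‖ ^ 2)
    (z : EuclideanSpace ℝ (Fin d)) (t : ℝ) (ht : 0 < t) :
    ∀ v : EuclideanSpace ℝ (Fin d),
      -‖v‖ ^ 2 - iteratedFDeriv ℝ 2 (fun w => Real.log (ouDensity d V t w)) z ![v, v] ≤
        (β - 1) * exp (-2 * t) / ((1 - exp (-2 * t)) * (β - 1) + 1) * ‖v‖ ^ 2 := by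
  set a := exp (-t) with ha
  have ha2 : exp (-2 * t) = a ^ 2 := by rw [ha, ← exp_nat_mul]; push_cast; ring_nf
  have ha0 : 0 < a := exp_pos _
  have ha1 : a < 1 := by rw [ha, exp_lt_one_iff]; linarith
  have hs : 0 < 1 - a ^ 2 := by nlinarith
  have hD : 0 < (1 - a ^ 2) * β + a ^ 2 := by positivity
  have hZ := integral_exp_pos hint
  set I : EuclideanSpace ℝ (Fin d) → ℝ := fun w =>
    ∫ x, exp (-‖w - a • x‖ ^ 2 / (2 * (1 - a ^ 2))) * exp (-V x) with hI
  have hIpos : ∀ w, 0 < I w := by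
    intro w
    have h := integrable_gaussian_mul hint a hs w
    simp only [hI, ← exp_add] at h ⊢
    exact integral_exp_pos h
  obtain ⟨C, hC⟩ : ∃ C : ℝ, ∀ w, log (ouDensity d V t w) = log (I w) + C := by
    have hc : 0 < (2 * π * (1 - a ^ 2)) ^ (-(d : ℝ) / 2) := rpow_pos_of_pos (by positivity) _
    refine ⟨log ((2 * π * (1 - a ^ 2)) ^ (-(d : ℝ) / 2) / ∫ y, exp (-V y)), fun w => ?_⟩
    rw [← log_mul (hIpos w).ne' (by positivity)]
    simp only [ouDensity, ← ha, ha2, ← mul_div_assoc, integral_div, hI]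
    congr 1
    ring
  have hconv := (convexOn_log_integral_gaussian_mul hint
    (convexOn_half_mul_sq_norm_sub hV hhess) hs hD).add_const C
  have hdiff : Differentiable ℝ fun w => log (I w) + C :=
    ((differentiable_integral_gaussian_mul hint a hs).log fun w => (hIpos w).ne').add_const C
  intro v
  simp only [hC, ha2]
  have key := neg_mul_sq_norm_le_iteratedFDeriv_two hdiff (c := β / ((1 - a ^ 2) * β + a ^ 2))
    (by positivity) (hconv.congr fun w _ => by simp only [Pi.add_apply]; ring) z v
  have hDeq : (1 - a ^ 2) * (β - 1) + 1 = (1 - a ^ 2) * β + a ^ 2 := by ring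
  have hcoef : β / ((1 - a ^ 2) * β + a ^ 2) =
      1 + (β - 1) * a ^ 2 / ((1 - a ^ 2) * β + a ^ 2) := by
    rw [eq_comm, ← sub_eq_zero]; field_simp; ring
  rw [hDeq]
  rw [hcoef] at key
  linarith
end

section
/- Let d ≥ 1 and let V : ℝ^d → ℝ be C² with Z_V := ∫ e^{−V} < ∞, Z_{2V} := ∫ e^{−2V} < ∞, ∇²V(x) ⪯ β I_d for all x (β > 0), μ(0) > 0, and finite second moment m_2 := ∫ ‖x‖² μ(x) dx < ∞ where μ = e^{−V}/Z_V. Let Φ_t := p_t^{2V}/p_t^V be the ratio of forward Ornstein–Uhlenbeck densities started at μ² = e^{−2V}/Z_{2V} and at μ respectively. Then for all t > 0, m_2(Φ_t) := ∫ ‖z‖² Φ_t(z) dz ≤ 2 e^{t(d+2)} (Z_V²/Z_{2V}) (β(1−e^{−2t}) + e^{−2t})^{d+2} · [m_2 + d(β+1) − 4 log μ(0) + 2d log(β/(2π))]. -/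
open Real MeasureTheory
open scoped RealInnerProductSpace

section Helpers

open Module Filter Topology

variable {F : Type*} [NormedAddCommGroup F] [InnerProductSpace ℝ F]

/-- A quadratic Taylor upper bound from an upper bound on the Hessian. -/
lemma le_add_inner_gradient_add_of_hessian_le [CompleteSpace F] {V : F → ℝ} (hV : ContDiff ℝ 2 V)
    {β : ℝ} (hhess : ∀ x v : F, iteratedFDeriv ℝ 2 V x ![v, v] ≤ β * ‖v‖ ^ 2) (x h : F) :
    V (x + h) ≤ V x + ⟪gradient V x, h⟫ + β / 2 * ‖h‖ ^ 2 := by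
  have hd1 : Differentiable ℝ V := hV.differentiable (by norm_num)
  have hd2 : Differentiable ℝ (fderiv ℝ V) :=
    (hV.fderiv_right (m := 1) (by norm_num)).differentiable (by norm_num)
  have hline : ∀ u : ℝ, HasDerivAt (fun u : ℝ => x + u • h) h u := fun u => by
    simpa using ((hasDerivAt_id u).smul_const h).const_add x
  have h1 : ∀ u : ℝ, HasDerivAt (fun u : ℝ => V (x + u • h)) (fderiv ℝ V (x + u • h) h) u :=
    fun u => (hd1 _).hasFDerivAt.comp_hasDerivAt u (hline u)
  have h2 : ∀ u : ℝ, HasDerivAt (fun u : ℝ => fderiv ℝ V (x + u • h) h)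
      (fderiv ℝ (fderiv ℝ V) (x + u • h) h h) u := fun u => by
    have := (hd2 (x + u • h)).hasFDerivAt.comp_hasDerivAt u (hline u)
    simpa using this.clm_apply (hasDerivAt_const u h)
  have hanti : Antitone fun u : ℝ => fderiv ℝ V (x + u • h) h - β * ‖h‖ ^ 2 * u := by
    have hder : ∀ u : ℝ, HasDerivAt (fun u : ℝ => fderiv ℝ V (x + u • h) h - β * ‖h‖ ^ 2 * u)
        (fderiv ℝ (fderiv ℝ V) (x + u • h) h h - β * ‖h‖ ^ 2) u := fun u => by
      convert! (h2 u).sub ((hasDerivAt_id u).const_mul (β * ‖h‖ ^ 2)) using 1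
      simp
    refine antitone_of_deriv_nonpos (fun u => (hder u).differentiableAt) fun u => ?_
    rw [(hder u).deriv]
    have := hhess (x + u • h) h
    rw [iteratedFDeriv_two_apply] at this
    simpa using this
  have hanti2 : AntitoneOn (fun u : ℝ => V (x + u • h) - fderiv ℝ V x h * u -
      β / 2 * ‖h‖ ^ 2 * u ^ 2) (Set.Icc 0 1) := by
    have hder : ∀ u : ℝ, HasDerivAt (fun u : ℝ => V (x + u • h) - fderiv ℝ V x h * u -
        β / 2 * ‖h‖ ^ 2 * u ^ 2)
        (fderiv ℝ V (x + u • h) h - fderiv ℝ V x h - β * ‖h‖ ^ 2 * u) u := fun u => by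
      convert! ((h1 u).sub ((hasDerivAt_id u).const_mul (fderiv ℝ V x h))).sub
        ((hasDerivAt_pow 2 u).const_mul (β / 2 * ‖h‖ ^ 2)) using 1
      simp; ring
    refine antitoneOn_of_deriv_nonpos (convex_Icc 0 1)
      (fun u _ => (hder u).continuousAt.continuousWithinAt)
      (fun u _ => (hder u).differentiableAt.differentiableWithinAt) fun u hu => ?_
    rw [interior_Icc] at hu
    rw [(hder u).deriv]
    have := hanti hu.1.le
    simp only [zero_smul, add_zero, mul_zero, sub_zero] at this
    linarith
  have := hanti2 (by simp : (0 : ℝ) ∈ Set.Icc (0 : ℝ) 1) (by simp : (1 : ℝ) ∈ Set.Icc (0 : ℝ) 1)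
    zero_le_one
  simp only [one_smul, zero_smul, add_zero, mul_zero] at this
  rw [inner_gradient_left]
  linarith

lemma continuous_gradient_of_contDiff [CompleteSpace F] {V : F → ℝ} (hV : ContDiff ℝ 2 V) :
    Continuous (gradient V) :=
  (InnerProductSpace.toDual ℝ F).symm.continuous.comp (hV.continuous_fderiv (by norm_num))

variable [FiniteDimensional ℝ F] [MeasurableSpace F] [BorelSpace F]

lemma integrable_exp_neg_mul_sq_norm {b : ℝ} (hb : 0 < b) :
    Integrable fun x : F => exp (-b * ‖x‖ ^ 2) := by
  refine Integrable.of_integral_ne_zero ?_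
  rw [GaussianFourier.integral_rexp_neg_mul_sq_norm hb]
  positivity

/-- Comparison of `∫ e^{-W}` with the Gaussian given by a quadratic upper bound for `W`. -/
lemma exp_neg_mul_gaussian_le_integral {W : F → ℝ} (hW : Integrable fun x => exp (-W x))
    {a : ℝ} (ha : 0 < a) (x l : F) (h : ∀ u, W (x + u) ≤ W x + ⟪l, u⟫ + a / 2 * ‖u‖ ^ 2) :
    exp (-W x) * exp (‖l‖ ^ 2 / (2 * a)) * (2 * π / a) ^ (finrank ℝ F / 2 : ℝ) ≤
      ∫ y, exp (-W y) := by
  rw [← integral_add_left_eq_self _ (x - a⁻¹ • l)]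
  have hG := GaussianFourier.integral_rexp_neg_mul_sq_norm (V := F) (half_pos ha)
  have : 2 * π / a = π / (a / 2) := by field_simp
  rw [this, ← hG, ← integral_const_mul]
  refine integral_mono ((integrable_exp_neg_mul_sq_norm (half_pos ha)).const_mul _)
    (hW.comp_add_left _) fun u => ?_
  rw [← exp_add, ← exp_add]
  refine exp_le_exp.2 ?_
  have := h (u - a⁻¹ • l)
  rw [show x - a⁻¹ • l + u = x + (u - a⁻¹ • l) by abel]
  rw [inner_sub_right, norm_sub_sq_real, inner_smul_right, inner_smul_right, norm_smul, mul_pow,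
    real_inner_self_eq_norm_sq, real_inner_comm l u, norm_inv, norm_eq_abs, inv_pow, sq_abs] at this
  have e : a / 2 * (‖u‖ ^ 2 - 2 * (a⁻¹ * ⟪u, l⟫) + (a ^ 2)⁻¹ * ‖l‖ ^ 2) =
    a / 2 * ‖u‖ ^ 2 - ⟪u, l⟫ + ‖l‖ ^ 2 / (2 * a) := by field_simp
  have e2 : a⁻¹ * ‖l‖ ^ 2 = 2 * (‖l‖ ^ 2 / (2 * a)) := by field_simp
  rw [real_inner_comm] at this
  linarith

/-- Directional second moment bound for the score of a density with a quadratic upper bound on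
its potential. -/
lemma integral_inner_sq_mul_exp_neg_le {W : F → ℝ} (hW : Integrable fun x => exp (-W x))
    (hWc : Continuous W) {G : F → F} (hG : Continuous G) {a : ℝ}
    (h : ∀ x u, W (x + u) ≤ W x + ⟪G x, u⟫ + a / 2 * ‖u‖ ^ 2) (e : F) :
    Integrable (fun x => ⟪G x, e⟫ ^ 2 * exp (-W x)) ∧
      ∫ x, ⟪G x, e⟫ ^ 2 * exp (-W x) ≤ a * ‖e‖ ^ 2 * ∫ x, exp (-W x) := by
  have key : ∀ u x : F, ⟪G x, u⟫ ^ 2 * exp (-W x) ≤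
      exp (a / 2 * ‖u‖ ^ 2) * (exp (-W (x + u)) + exp (-W (x + -u))) - 2 * exp (-W x) := by
    intro u x
    have h1 : exp (-⟪G x, u⟫) * exp (-W x) ≤ exp (a / 2 * ‖u‖ ^ 2) * exp (-W (x + u)) := by
      rw [← exp_add, ← exp_add]
      exact exp_le_exp.2 (by linarith [h x u])
    have h2 : exp (⟪G x, u⟫) * exp (-W x) ≤ exp (a / 2 * ‖u‖ ^ 2) * exp (-W (x + -u)) := by
      rw [← exp_add, ← exp_add]
      refine exp_le_exp.2 ?_
      have := h x (-u)
      rw [inner_neg_right, norm_neg] at this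
      linarith
    have h3 : ⟪G x, u⟫ ^ 2 + 2 ≤ exp (⟪G x, u⟫) + exp (-⟪G x, u⟫) := by
      rw [← sub_nonneg]
      have hc := cosh_eq ⟪G x, u⟫
      have hc2 := cosh_two_mul (⟪G x, u⟫ / 2)
      have hc3 := cosh_sq (⟪G x, u⟫ / 2)
      have hs : (⟪G x, u⟫ / 2) ^ 2 ≤ sinh (⟪G x, u⟫ / 2) ^ 2 := by
        rw [sq_le_sq, abs_sinh]
        exact self_le_sinh_iff.2 (abs_nonneg _)
      rw [show 2 * (⟪G x, u⟫ / 2) = ⟪G x, u⟫ by ring] at hc2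
      linarith
    nlinarith [exp_pos (-W x)]
  have hint : ∀ u : F, Integrable fun x => exp (a / 2 * ‖u‖ ^ 2) *
      (exp (-W (x + u)) + exp (-W (x + -u))) - 2 * exp (-W x) := fun u =>
    (((hW.comp_add_right u).add (hW.comp_add_right (-u))).const_mul _).sub (hW.const_mul 2)
  have hI : ∀ u : F, Integrable (fun x => ⟪G x, u⟫ ^ 2 * exp (-W x)) := fun u => by
    refine (hint u).mono' (by fun_prop) (ae_of_all _ fun x => ?_)
    rw [norm_of_nonneg (by positivity)]
    exact key u x
  refine ⟨hI e, ?_⟩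
  set Z := ∫ x, exp (-W x)
  have hZ0 : 0 ≤ Z := integral_nonneg fun _ => (exp_pos _).le
  have hb : ∀ u : F, ∫ x, ⟪G x, u⟫ ^ 2 * exp (-W x) ≤ 2 * (exp (a / 2 * ‖u‖ ^ 2) - 1) * Z := by
    intro u
    refine (integral_mono (hI u) (hint u) (key u)).trans_eq ?_
    have hadd : Integrable fun x => exp (-W (x + u)) + exp (-W (x + -u)) :=
      (hW.comp_add_right u).add (hW.comp_add_right (-u))
    rw [integral_sub (hadd.const_mul _) (hW.const_mul 2), integral_const_mul, integral_const_mul,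
      integral_add (hW.comp_add_right u) (hW.comp_add_right (-u)),
      integral_add_right_eq_self (fun x => exp (-W x)),
      integral_add_right_eq_self (fun x => exp (-W x))]
    ring
  have hlim : Tendsto (fun ε : ℝ => a * ‖e‖ ^ 2 * exp (a / 2 * (ε ^ 2 * ‖e‖ ^ 2)) * Z) (𝓝[>] 0)
      (𝓝 (a * ‖e‖ ^ 2 * Z)) := by
    have : Continuous fun ε : ℝ => a * ‖e‖ ^ 2 * exp (a / 2 * (ε ^ 2 * ‖e‖ ^ 2)) * Z := by fun_prop
    simpa using (this.tendsto 0).mono_left nhdsWithin_le_nhds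
  refine ge_of_tendsto hlim ?_
  filter_upwards [self_mem_nhdsWithin] with ε hε
  have hε : 0 < ε := hε
  have h1 := hb (ε • e)
  simp only [inner_smul_right, norm_smul, mul_pow, norm_eq_abs, sq_abs, mul_assoc] at h1
  rw [integral_const_mul] at h1
  set r := a / 2 * (ε ^ 2 * ‖e‖ ^ 2) with hr
  have h2 : exp r - 1 ≤ r * exp r := by
    have h3 := add_one_le_exp (-r)
    have h4 : exp (-r) * exp r = 1 := by rw [← exp_add]; simp
    nlinarith [exp_pos r]
  have h5 : ε ^ 2 * ∫ x, ⟪G x, e⟫ ^ 2 * exp (-W x) ≤ ε ^ 2 * (a * ‖e‖ ^ 2 * exp r * Z) := by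
    calc _ ≤ 2 * ((exp r - 1) * Z) := h1
      _ ≤ 2 * ((r * exp r) * Z) := by gcongr
      _ = _ := by rw [hr]; ring
  exact le_of_mul_le_mul_left h5 (by positivity)

/-- `∫ ‖∇W‖² e^{-W} ≤ a n ∫ e^{-W}` when `W` has a quadratic upper bound with constant `a`. -/
lemma integral_norm_sq_mul_exp_neg_le {W : F → ℝ} (hW : Integrable fun x => exp (-W x))
    (hWc : Continuous W) {G : F → F} (hG : Continuous G) {a : ℝ}
    (h : ∀ x u, W (x + u) ≤ W x + ⟪G x, u⟫ + a / 2 * ‖u‖ ^ 2) :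
    Integrable (fun x => ‖G x‖ ^ 2 * exp (-W x)) ∧
      ∫ x, ‖G x‖ ^ 2 * exp (-W x) ≤ finrank ℝ F * a * ∫ x, exp (-W x) := by
  have hd := fun i => integral_inner_sq_mul_exp_neg_le hW hWc hG h (stdOrthonormalBasis ℝ F i)
  simp_rw [← (stdOrthonormalBasis ℝ F).sum_sq_inner_left, Finset.sum_mul]
  refine ⟨integrable_finsetSum _ fun i _ => (hd i).1, ?_⟩
  rw [integral_finsetSum _ fun i _ => (hd i).1]
  refine (Finset.sum_le_sum fun i _ => (hd i).2).trans_eq ?_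
  simp [mul_assoc]

/-- A lower bound on the second moment of a density with a quadratic upper bound on its
potential. -/
lemma finrank_mul_le_mul_integral_norm_sq {W : F → ℝ} (hW : Integrable fun x => exp (-W x))
    (hWc : Continuous W) {G : F → F} (hG : Continuous G) {a : ℝ} (ha : 0 < a)
    (h : ∀ x u, W (x + u) ≤ W x + ⟪G x, u⟫ + a / 2 * ‖u‖ ^ 2)
    (hm : Integrable fun x => ‖x‖ ^ 2 * exp (-W x)) :
    finrank ℝ F * ∫ x, exp (-W x) ≤ a * ∫ x, ‖x‖ ^ 2 * exp (-W x) := by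
  obtain ⟨hGi, hGle⟩ := integral_norm_sq_mul_exp_neg_le hW hWc hG h
  set n := finrank ℝ F
  set Z := ∫ x, exp (-W x)
  set M := ∫ x, ‖x‖ ^ 2 * exp (-W x)
  set B := ∫ x, ‖G x‖ ^ 2 * exp (-W x)
  have hamgm : ∀ x : F, |⟪G x, x⟫| ≤ a / 2 * ‖x‖ ^ 2 + 1 / (2 * a) * ‖G x‖ ^ 2 := fun x => by
    refine (abs_real_inner_le_norm _ _).trans ?_
    have : a / 2 * ‖x‖ ^ 2 + 1 / (2 * a) * ‖G x‖ ^ 2 - ‖G x‖ * ‖x‖ =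
      (a * ‖x‖ - ‖G x‖) ^ 2 / (2 * a) := by field_simp; ring
    have : 0 ≤ (a * ‖x‖ - ‖G x‖) ^ 2 / (2 * a) := by positivity
    linarith
  have hdom : Integrable fun x => a / 2 * (‖x‖ ^ 2 * exp (-W x)) +
      1 / (2 * a) * (‖G x‖ ^ 2 * exp (-W x)) := (hm.const_mul _).add (hGi.const_mul _)
  have hX : Integrable fun x => ⟪G x, x⟫ * exp (-W x) := by
    refine hdom.mono' (by fun_prop) (ae_of_all _ fun x => ?_)
    rw [norm_mul, norm_of_nonneg (exp_pos (-W x)).le, norm_eq_abs]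
    nlinarith [hamgm x, exp_pos (-W x)]
  set X := ∫ x, ⟪G x, x⟫ * exp (-W x)
  have hXle : X ≤ a / 2 * M + 1 / (2 * a) * B := by
    have : ∫ x, (a / 2 * (‖x‖ ^ 2 * exp (-W x)) + 1 / (2 * a) * (‖G x‖ ^ 2 * exp (-W x))) =
        a / 2 * M + 1 / (2 * a) * B := by
      rw [integral_add (hm.const_mul _) (hGi.const_mul _), integral_const_mul, integral_const_mul]
    rw [← this]
    refine integral_mono hX hdom fun x => ?_
    have := (le_abs_self _).trans (hamgm x)
    simp only
    nlinarith [exp_pos (-W x)]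
  have hXge : n * Z ≤ X := by
    have hlim : Tendsto (fun ε : ℝ => (1 + n * ε) * (X + ε * (a / 2) * M)) (𝓝[>] 0) (𝓝 X) := by
      have : Continuous fun ε : ℝ => (1 + n * ε) * (X + ε * (a / 2) * M) := by fun_prop
      simpa using (this.tendsto 0).mono_left nhdsWithin_le_nhds
    refine ge_of_tendsto hlim ?_
    filter_upwards [self_mem_nhdsWithin] with ε hε
    have hε : 0 < ε := hε
    have hpt : ∀ x : F, exp (-W x) - ε * (⟪G x, x⟫ * exp (-W x)) -
        ε ^ 2 * (a / 2) * (‖x‖ ^ 2 * exp (-W x)) ≤ exp (-W ((1 + ε) • x)) := fun x => by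
      have h1 := h x (ε • x)
      rw [inner_smul_right, norm_smul, mul_pow, norm_eq_abs, sq_abs] at h1
      have h2 := add_one_le_exp (-(ε * ⟪G x, x⟫ + a / 2 * (ε ^ 2 * ‖x‖ ^ 2)))
      have h3 : exp (-W x) * exp (-(ε * ⟪G x, x⟫ + a / 2 * (ε ^ 2 * ‖x‖ ^ 2))) ≤
          exp (-W ((1 + ε) • x)) := by
        rw [← exp_add, add_smul, one_smul]
        exact exp_le_exp.2 (by linarith)
      nlinarith [exp_pos (-W x)]
    have hs : Integrable fun x : F => exp (-W ((1 + ε) • x)) :=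
      hW.comp_smul (by positivity)
    have hsub : Integrable fun x => exp (-W x) - ε * (⟪G x, x⟫ * exp (-W x)) :=
      hW.sub (hX.const_mul ε)
    have hi : ∫ x, (exp (-W x) - ε * (⟪G x, x⟫ * exp (-W x)) -
        ε ^ 2 * (a / 2) * (‖x‖ ^ 2 * exp (-W x))) ≤ ∫ x : F, exp (-W ((1 + ε) • x)) :=
      integral_mono (hsub.sub (hm.const_mul (ε ^ 2 * (a / 2)))) hs hpt
    rw [integral_sub hsub (hm.const_mul _), integral_sub hW (hX.const_mul ε),
      integral_const_mul, integral_const_mul,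
      Measure.integral_comp_smul_of_nonneg volume (fun x => exp (-W x)) (1 + ε)
        (hR := by positivity), smul_eq_mul, ← div_eq_inv_mul, le_div_iff₀ (by positivity)] at hi
    change (Z - ε * X - ε ^ 2 * (a / 2) * M) * (1 + ε) ^ n ≤ Z at hi
    have hZ : 0 ≤ Z := integral_nonneg fun _ => (exp_pos _).le
    have hn : (0 : ℝ) ≤ n := n.cast_nonneg
    set R := X + ε * (a / 2) * M with hR
    have hQ : Z - ε * X - ε ^ 2 * (a / 2) * M = Z - ε * R := by rw [hR]; ring
    rw [hQ] at hi
    rcases le_total (Z - ε * R) 0 with h0 | h0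
    · have hR0 : 0 ≤ R := by
        by_contra! hneg
        nlinarith
      nlinarith
    · have hpow := one_add_mul_le_pow (by linarith : (-2 : ℝ) ≤ ε) n
      have := (mul_le_mul_of_nonneg_left hpow h0).trans hi
      refine le_of_mul_le_mul_left ?_ hε
      nlinarith
  have hB : 1 / (2 * a) * B ≤ 1 / (2 * a) * (n * a * Z) := by gcongr
  have : 1 / (2 * a) * (n * a * Z) = n * Z / 2 := by field_simp
  linarith

/-- Second moment of a shifted Gaussian. -/
lemma lintegral_norm_sq_mul_gaussian_le {b : ℝ} (hb : 0 < b) (z₀ : F) :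
    ∫⁻ z : F, ENNReal.ofReal (‖z‖ ^ 2 * exp (-b * ‖z - z₀‖ ^ 2)) ≤
      ENNReal.ofReal ((‖z₀‖ ^ 2 + finrank ℝ F / (2 * b)) * (π / b) ^ (finrank ℝ F / 2 : ℝ)) := by
  have hI := integrable_exp_neg_mul_sq_norm (F := F) hb
  obtain ⟨hm, hle⟩ := integral_norm_sq_mul_exp_neg_le (F := F) (W := fun x => b * ‖x‖ ^ 2)
    (G := fun x => (2 * b) • x) (a := 2 * b) (by simpa using hI) (by fun_prop) (by fun_prop)
    (fun x u => by
      rw [norm_add_sq_real, inner_smul_left]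
      simp only [conj_trivial]
      linarith)
  simp only [norm_smul, mul_pow, norm_eq_abs, sq_abs, ← neg_mul, mul_assoc] at hm hle
  rw [integral_const_mul, integral_const_mul,
    GaussianFourier.integral_rexp_neg_mul_sq_norm hb] at hle
  have hm' : Integrable fun u : F => ‖u‖ ^ 2 * exp (-b * ‖u‖ ^ 2) := by
    refine (hm.const_mul (1 / (4 * b ^ 2))).congr (ae_of_all _ fun u => ?_)
    simp only
    field_simp
    norm_num
  set g := (π / b) ^ (finrank ℝ F / 2 : ℝ)
  have hM : ∫ u : F, ‖u‖ ^ 2 * exp (-b * ‖u‖ ^ 2) ≤ finrank ℝ F / (2 * b) * g := by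
    rw [div_mul_eq_mul_div, le_div_iff₀ (by positivity)]
    refine le_of_mul_le_mul_left ?_ (by positivity : 0 < 2 * b)
    linarith
  have hX : Integrable fun u : F => ⟪u, z₀⟫ * exp (-b * ‖u‖ ^ 2) := by
    refine (hm'.add (hI.const_mul (‖z₀‖ ^ 2))).mono' (by fun_prop) (ae_of_all _ fun u => ?_)
    rw [norm_mul, norm_of_nonneg (exp_pos _).le, norm_eq_abs]
    have h1 := abs_real_inner_le_norm u z₀
    have h2 : |⟪u, z₀⟫| ≤ ‖u‖ ^ 2 + ‖z₀‖ ^ 2 := by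
      nlinarith [sq_nonneg (‖u‖ - ‖z₀‖), sq_nonneg ‖u‖, sq_nonneg ‖z₀‖]
    exact (mul_le_mul_of_nonneg_right h2 (exp_pos _).le).trans_eq (add_mul _ _ _)
  have hX0 : ∫ u : F, ⟪u, z₀⟫ * exp (-b * ‖u‖ ^ 2) = 0 := by
    have := integral_neg_eq_self (fun u : F => ⟪u, z₀⟫ * exp (-b * ‖u‖ ^ 2)) volume
    simp only [inner_neg_left, norm_neg, neg_mul, integral_neg] at this ⊢
    linarith
  have hexp : ∀ u : F, ‖u + z₀‖ ^ 2 * exp (-b * ‖u‖ ^ 2) = ‖u‖ ^ 2 * exp (-b * ‖u‖ ^ 2) +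
      2 * (⟪u, z₀⟫ * exp (-b * ‖u‖ ^ 2)) + ‖z₀‖ ^ 2 * exp (-b * ‖u‖ ^ 2) := fun u => by
    rw [norm_add_sq_real]
    ring
  have h12 : Integrable fun u : F => ‖u‖ ^ 2 * exp (-b * ‖u‖ ^ 2) +
      2 * (⟪u, z₀⟫ * exp (-b * ‖u‖ ^ 2)) := hm'.add (hX.const_mul 2)
  rw [← lintegral_add_right_eq_self _ z₀]
  simp only [add_sub_cancel_right]
  rw [← ofReal_integral_eq_lintegral_ofReal]
  · refine ENNReal.ofReal_le_ofReal ?_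
    simp_rw [hexp]
    rw [integral_add h12 (hI.const_mul _), integral_add hm' (hX.const_mul 2), integral_const_mul,
      integral_const_mul, hX0, GaussianFourier.integral_rexp_neg_mul_sq_norm hb]
    change _ + _ + ‖z₀‖ ^ 2 * g ≤ _
    linarith
  · simp_rw [hexp]
    exact h12.add (hI.const_mul _)
  · exact ae_of_all _ fun u => by positivity

/-- A pointwise upper bound for the Ornstein–Uhlenbeck kernel against `e^{-V}`, relative to the
smoothed density, by a Gaussian in `z`. -/
lemma kernel_mul_exp_neg_le {V : F → ℝ} (hV : Integrable fun x => exp (-V x))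
    (hVc : Continuous V) {G : F → F} {β : ℝ} (hβ : 0 < β)
    (h : ∀ x u, V (x + u) ≤ V x + ⟪G x, u⟫ + β / 2 * ‖u‖ ^ 2) {l s K : ℝ} (hl : 0 < l) (hs : 0 < s)
    (hK : K = β * s + l ^ 2) (x z : F) :
    exp (-‖z - l • x‖ ^ 2 / (2 * s)) * exp (-V x) ≤
      (2 * π * s / K) ^ (-(finrank ℝ F / 2 : ℝ)) *
        exp (-(l ^ 2 / (2 * s * K)) * ‖z - (l • x + (s / l) • G x)‖ ^ 2) *
        ∫ y, exp (-‖z - l • y‖ ^ 2 / (2 * s)) * exp (-V y) := by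
  have hK0 : 0 < K := by rw [hK]; positivity
  have hint : Integrable fun y => exp (-(V y + ‖z - l • y‖ ^ 2 / (2 * s))) := by
    refine hV.mono' (by fun_prop) (ae_of_all _ fun y => ?_)
    rw [norm_of_nonneg (exp_pos _).le]
    refine exp_le_exp.2 ?_
    have : 0 ≤ ‖z - l • y‖ ^ 2 / (2 * s) := by positivity
    linarith
  have hq : ∀ u, V (x + u) + ‖z - l • (x + u)‖ ^ 2 / (2 * s) ≤
      V x + ‖z - l • x‖ ^ 2 / (2 * s) + ⟪G x - (l / s) • (z - l • x), u⟫ +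
        (K / s) / 2 * ‖u‖ ^ 2 := fun u => by
    have h1 := h x u
    have h2 : ‖z - l • (x + u)‖ ^ 2 =
        ‖z - l • x‖ ^ 2 - 2 * (l * ⟪z - l • x, u⟫) + l ^ 2 * ‖u‖ ^ 2 := by
      rw [smul_add, ← sub_sub, norm_sub_sq_real, inner_smul_right, norm_smul, mul_pow,
        norm_eq_abs, sq_abs]
    rw [h2, inner_sub_left (G x), inner_smul_left]
    simp only [conj_trivial]
    have h3 : (‖z - l • x‖ ^ 2 - 2 * (l * ⟪z - l • x, u⟫) + l ^ 2 * ‖u‖ ^ 2) / (2 * s) =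
        ‖z - l • x‖ ^ 2 / (2 * s) - l / s * ⟪z - l • x, u⟫ + l ^ 2 / s / 2 * ‖u‖ ^ 2 := by
      field_simp
    have h4 : K / s / 2 * ‖u‖ ^ 2 = β / 2 * ‖u‖ ^ 2 + l ^ 2 / s / 2 * ‖u‖ ^ 2 := by
      rw [hK]; field_simp
    linarith
  have hmain := exp_neg_mul_gaussian_le_integral hint (div_pos hK0 hs) x _ hq
  have hn : ‖G x - (l / s) • (z - l • x)‖ ^ 2 / (2 * (K / s)) =
      l ^ 2 / (2 * s * K) * ‖z - (l • x + (s / l) • G x)‖ ^ 2 := by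
    have : G x - (l / s) • (z - l • x) = (-(l / s)) • (z - (l • x + (s / l) • G x)) := by
      have hG1 : (l / s) • (s / l) • G x = G x := by
        rw [smul_smul, show l / s * (s / l) = 1 by field_simp, one_smul]
      rw [← sub_sub, neg_smul, smul_sub (l / s) (z - l • x), hG1, neg_sub]
    rw [this, norm_smul, mul_pow, norm_eq_abs, sq_abs]
    field_simp
  rw [hn, show 2 * π / (K / s) = 2 * π * s / K by field_simp] at hmain
  have hsplit : ∀ y, exp (-(V y + ‖z - l • y‖ ^ 2 / (2 * s))) =
      exp (-‖z - l • y‖ ^ 2 / (2 * s)) * exp (-V y) := fun y => by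
    rw [← exp_add]; congr 1; ring
  simp_rw [hsplit] at hmain
  set D := ∫ y, exp (-‖z - l • y‖ ^ 2 / (2 * s)) * exp (-V y)
  rw [rpow_neg (by positivity), neg_mul, exp_neg (_ * _)]
  set c := (2 * π * s / K) ^ (finrank ℝ F / 2 : ℝ)
  have hc0 : 0 < c := by positivity
  set q := exp (l ^ 2 / (2 * s * K) * ‖z - (l • x + (s / l) • G x)‖ ^ 2)
  have hq0 : 0 < q := exp_pos _
  rw [← mul_inv, inv_mul_eq_div, le_div_iff₀ (by positivity)]
  linarith

/-- The second moment bound for the ratio of smoothed densities, before normalization. -/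
lemma lintegral_norm_sq_mul_ratio_le {V : F → ℝ} (hV : Integrable fun x => exp (-V x))
    (hVc : Continuous V) (hV2 : Integrable fun x => exp (-(2 * V x)))
    (hm : Integrable fun x => ‖x‖ ^ 2 * exp (-V x))
    {G : F → F} (hG : Continuous G) {β : ℝ} (hβ : 0 < β)
    (h : ∀ x u, V (x + u) ≤ V x + ⟪G x, u⟫ + β / 2 * ‖u‖ ^ 2) {l s K : ℝ} (hl : 0 < l) (hs : 0 < s)
    (hK : K = β * s + l ^ 2) :
    ∫⁻ z : F, ENNReal.ofReal (‖z‖ ^ 2 *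
        ((∫ x, exp (-‖z - l • x‖ ^ 2 / (2 * s)) * exp (-(2 * V x))) /
          ∫ x, exp (-‖z - l • x‖ ^ 2 / (2 * s)) * exp (-V x))) ≤
      ENNReal.ofReal (2 * (K / l) ^ (finrank ℝ F + 2) * ∫ x, ‖x‖ ^ 2 * exp (-V x)) := by
  have hK0 : 0 < K := by rw [hK]; positivity
  set n := finrank ℝ F
  set b := l ^ 2 / (2 * s * K) with hb
  have hb0 : 0 < b := by positivity
  set c := (2 * π * s / K) ^ (-(n / 2 : ℝ)) with hc
  have hc0 : 0 < c := by positivity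
  have hker : ∀ z x : F, exp (-‖z - l • x‖ ^ 2 / (2 * s)) ≤ 1 := fun z x => by
    refine exp_le_one_iff.2 ?_
    rw [neg_div]
    have : 0 ≤ ‖z - l • x‖ ^ 2 / (2 * s) := by positivity
    linarith
  have hintV : ∀ z : F, Integrable fun x => exp (-‖z - l • x‖ ^ 2 / (2 * s)) * exp (-V x) :=
    fun z => hV.mono' (by fun_prop) (ae_of_all _ fun x => by
      rw [norm_of_nonneg (by positivity)]
      exact mul_le_of_le_one_left (exp_pos _).le (hker z x))
  have hintV2 : ∀ z : F, Integrable fun x =>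
      exp (-‖z - l • x‖ ^ 2 / (2 * s)) * exp (-(2 * V x)) :=
    fun z => hV2.mono' (by fun_prop) (ae_of_all _ fun x => by
      rw [norm_of_nonneg (by positivity)]
      exact mul_le_of_le_one_left (exp_pos _).le (hker z x))
  have hD : ∀ z : F, 0 < ∫ x, exp (-‖z - l • x‖ ^ 2 / (2 * s)) * exp (-V x) := fun z => by
    refine (integral_pos_iff_support_of_nonneg (fun x => by positivity) (hintV z)).2 ?_
    have : Function.support (fun x => exp (-‖z - l • x‖ ^ 2 / (2 * s)) * exp (-V x)) =
        Set.univ := Set.eq_univ_of_forall fun x => by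
      have : 0 < exp (-‖z - l • x‖ ^ 2 / (2 * s)) * exp (-V x) := by positivity
      exact this.ne'
    rw [this]
    exact isOpen_univ.measure_pos volume Set.univ_nonempty
  have hpt : ∀ z : F, ENNReal.ofReal (‖z‖ ^ 2 *
        ((∫ x, exp (-‖z - l • x‖ ^ 2 / (2 * s)) * exp (-(2 * V x))) /
          ∫ x, exp (-‖z - l • x‖ ^ 2 / (2 * s)) * exp (-V x))) ≤
      ∫⁻ x, ENNReal.ofReal (c * exp (-V x)) *
        ENNReal.ofReal (‖z‖ ^ 2 * exp (-b * ‖z - (l • x + (s / l) • G x)‖ ^ 2)) := fun z => by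
    rw [← integral_div, ← integral_const_mul, ofReal_integral_eq_lintegral_ofReal
      (((hintV2 z).div_const _).const_mul _) (ae_of_all _ fun x => by
        have := hD z
        positivity)]
    refine lintegral_mono fun x => ?_
    rw [← ENNReal.ofReal_mul (by positivity)]
    refine ENNReal.ofReal_le_ofReal ?_
    have h1 := kernel_mul_exp_neg_le hV hVc hβ h hl hs hK x z
    rw [← div_le_iff₀ (hD z)] at h1
    have h2 : exp (-(2 * V x)) = exp (-V x) * exp (-V x) := by rw [← exp_add]; ring_nf
    rw [h2]
    calc _ = ‖z‖ ^ 2 * exp (-V x) * (exp (-‖z - l • x‖ ^ 2 / (2 * s)) * exp (-V x) /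
          ∫ x, exp (-‖z - l • x‖ ^ 2 / (2 * s)) * exp (-V x)) := by ring
      _ ≤ ‖z‖ ^ 2 * exp (-V x) * (c * exp (-b * ‖z - (l • x + (s / l) • G x)‖ ^ 2)) := by
        gcongr
      _ = _ := by ring
  refine (lintegral_mono hpt).trans ?_
  rw [lintegral_lintegral_swap (Measurable.aemeasurable (by
    have := hG.measurable
    have := hVc.measurable
    unfold Function.uncurry
    fun_prop))]
  obtain ⟨hGi, hGle⟩ := integral_norm_sq_mul_exp_neg_le hV hVc hG h
  have hMge := finrank_mul_le_mul_integral_norm_sq hV hVc hG hβ h hm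
  have hconst : c * (π / b) ^ (n / 2 : ℝ) = (K / l) ^ n := by
    rw [hc, hb, rpow_neg (by positivity), inv_mul_eq_div, ← div_rpow (by positivity) (by positivity),
      show π / (l ^ 2 / (2 * s * K)) / (2 * π * s / K) = (K / l) ^ (2 : ℝ) by
        rw [rpow_two]; field_simp,
      ← rpow_mul (by positivity), mul_div_cancel₀ _ two_ne_zero, rpow_natCast]
  have hin : ∀ x : F, ∫⁻ z, ENNReal.ofReal (c * exp (-V x)) *
        ENNReal.ofReal (‖z‖ ^ 2 * exp (-b * ‖z - (l • x + (s / l) • G x)‖ ^ 2)) ≤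
      ENNReal.ofReal ((K / l) ^ n * ((l ^ 2 + s * β) * (‖x‖ ^ 2 * exp (-V x)) +
        (s / β + s ^ 2 / l ^ 2) * (‖G x‖ ^ 2 * exp (-V x)) +
          n * (s * K / l ^ 2) * exp (-V x))) := fun x => by
    rw [lintegral_const_mul' _ _ ENNReal.ofReal_ne_top]
    refine (mul_le_mul_right (lintegral_norm_sq_mul_gaussian_le hb0 _) _).trans ?_
    rw [← ENNReal.ofReal_mul (by positivity)]
    refine ENNReal.ofReal_le_ofReal ?_
    have h1 : ‖l • x + (s / l) • G x‖ ^ 2 ≤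
        (l ^ 2 + s * β) * ‖x‖ ^ 2 + (s / β + s ^ 2 / l ^ 2) * ‖G x‖ ^ 2 := by
      have h2 : 2 * ⟪x, G x⟫ ≤ β * ‖x‖ ^ 2 + 1 / β * ‖G x‖ ^ 2 := by
        have h3 := real_inner_le_norm x (G x)
        have h4 : β * ‖x‖ ^ 2 + 1 / β * ‖G x‖ ^ 2 - 2 * (‖x‖ * ‖G x‖) =
          (β * ‖x‖ - ‖G x‖) ^ 2 / β := by field_simp; ring
        have h5 : 0 ≤ (β * ‖x‖ - ‖G x‖) ^ 2 / β := by positivity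
        linarith
      rw [norm_add_sq_real, inner_smul_left, inner_smul_right, norm_smul, norm_smul, mul_pow,
        mul_pow, norm_eq_abs, norm_eq_abs, sq_abs, sq_abs]
      simp only [conj_trivial]
      have h6 : 2 * (l * (s / l * ⟪x, G x⟫)) = s * (2 * ⟪x, G x⟫) := by field_simp
      have h7 := mul_le_mul_of_nonneg_left h2 hs.le
      rw [h6, div_pow]
      linear_combination h7
    have h8 : (n : ℝ) / (2 * b) = n * (s * K / l ^ 2) := by rw [hb]; field_simp
    rw [h8]
    calc _ = c * (π / b) ^ (n / 2 : ℝ) * ((‖l • x + (s / l) • G x‖ ^ 2 + n * (s * K / l ^ 2)) *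
          exp (-V x)) := by ring
      _ ≤ c * (π / b) ^ (n / 2 : ℝ) * (((l ^ 2 + s * β) * ‖x‖ ^ 2 +
          (s / β + s ^ 2 / l ^ 2) * ‖G x‖ ^ 2 + n * (s * K / l ^ 2)) * exp (-V x)) := by gcongr
      _ = _ := by rw [hconst]; ring
  refine (lintegral_mono hin).trans ?_
  have hi12 : Integrable fun x => (l ^ 2 + s * β) * (‖x‖ ^ 2 * exp (-V x)) +
        (s / β + s ^ 2 / l ^ 2) * (‖G x‖ ^ 2 * exp (-V x)) :=
    (hm.const_mul _).add (hGi.const_mul _)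
  have hi : Integrable fun x => (K / l) ^ n * ((l ^ 2 + s * β) * (‖x‖ ^ 2 * exp (-V x)) +
        (s / β + s ^ 2 / l ^ 2) * (‖G x‖ ^ 2 * exp (-V x)) +
          n * (s * K / l ^ 2) * exp (-V x)) := (hi12.add (hV.const_mul _)).const_mul _
  rw [← ofReal_integral_eq_lintegral_ofReal hi]
  swap
  · exact ae_of_all _ fun x => by positivity
  refine ENNReal.ofReal_le_ofReal ?_
  rw [integral_const_mul, integral_add hi12 (hV.const_mul _),
    integral_add (hm.const_mul _) (hGi.const_mul _), integral_const_mul, integral_const_mul,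
    integral_const_mul]
  have hrhs : 2 * (K / l) ^ (n + 2) * ∫ x, ‖x‖ ^ 2 * exp (-V x) =
      (K / l) ^ n * (2 * (K / l) ^ 2 * ∫ x, ‖x‖ ^ 2 * exp (-V x)) := by ring
  rw [hrhs]
  refine mul_le_mul_of_nonneg_left ?_ (by positivity)
  set Z := ∫ x, exp (-V x)
  set M := ∫ x, ‖x‖ ^ 2 * exp (-V x)
  set B := ∫ x, ‖G x‖ ^ 2 * exp (-V x)
  have hM0 : 0 ≤ M := integral_nonneg fun _ => by positivity
  have hB : B ≤ β ^ 2 * M := by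
    refine hGle.trans ?_
    have := mul_le_mul_of_nonneg_left hMge hβ.le
    linear_combination this
  calc _ ≤ (l ^ 2 + s * β) * M + (s / β + s ^ 2 / l ^ 2) * (β ^ 2 * M) +
        s * K / l ^ 2 * (β * M) := by
        rw [mul_comm (n : ℝ), mul_assoc (s * K / l ^ 2)]
        gcongr
    _ = (K ^ 2 + K * (s * β)) * M / l ^ 2 := by rw [hK]; field_simp; ring
    _ ≤ (K ^ 2 + K * K) * M / l ^ 2 := by
        have : s * β ≤ K := by rw [hK, mul_comm s]; linarith [sq_nonneg l]
        gcongr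
    _ = _ := by rw [div_pow]; ring

end Helpers

/-- For `μ = e^{-V}/Z_V` `β`-semi-log-convex (`β > 0`), `μ(0) > 0`, with
finite second moment `m₂`, the second moment of the ratio `Φ_t = p_t^{2V}/p_t^V` satisfies, for
`t > 0`, `m_2(Φ_t) ≤ 2 e^{t(d+2)} (Z_V²/Z_{2V}) (β(1-e^{-2t})+e^{-2t})^{d+2}
  (m₂ + d(β+1) - 4 log μ(0) + 2d log(β/(2π)))`. -/
theorem ratio_second_moment_bound
    (d : ℕ) (hd : 1 ≤ d) (V : EuclideanSpace ℝ (Fin d) → ℝ)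
    (hV : ContDiff ℝ 2 V)
    (hint : Integrable fun x : EuclideanSpace ℝ (Fin d) => exp (-V x))
    (hint2 : Integrable fun x : EuclideanSpace ℝ (Fin d) => exp (-(2 * V x)))
    (hm2 : Integrable fun x : EuclideanSpace ℝ (Fin d) => ‖x‖ ^ 2 * exp (-V x))
    (hμ0 : 0 < exp (-V 0) / ∫ x : EuclideanSpace ℝ (Fin d), exp (-V x))
    (β : ℝ) (hβ : 0 < β)
    (hhess : ∀ x v : EuclideanSpace ℝ (Fin d),
      iteratedFDeriv ℝ 2 V x ![v, v] ≤ β * ‖v‖ ^ 2)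
    (t : ℝ) (ht : 0 < t) :
    ∫⁻ z : EuclideanSpace ℝ (Fin d),
        ENNReal.ofReal (‖z‖ ^ 2 *
          (ouDensity d (fun x => 2 * V x) t z / ouDensity d V t z)) ≤
      ENNReal.ofReal
        (2 * exp (t * (d + 2)) *
          ((∫ x : EuclideanSpace ℝ (Fin d), exp (-V x)) ^ 2 /
            ∫ x : EuclideanSpace ℝ (Fin d), exp (-(2 * V x))) *
          (β * (1 - exp (-2 * t)) + exp (-2 * t)) ^ (d + 2) *
          ((∫ x : EuclideanSpace ℝ (Fin d), ‖x‖ ^ 2 *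
              (exp (-V x) / ∫ y : EuclideanSpace ℝ (Fin d), exp (-V y))) +
            d * (β + 1) -
            4 * Real.log (exp (-V 0) / ∫ x : EuclideanSpace ℝ (Fin d), exp (-V x)) +
            2 * d * Real.log (β / (2 * π)))) := by
  have hf : Module.finrank ℝ (EuclideanSpace ℝ (Fin d)) = d := by simp
  have hVc : Continuous V := hV.continuous
  have hquad := le_add_inner_gradient_add_of_hessian_le hV hhess
  set s := 1 - exp (-2 * t) with hs
  have hs0 : 0 < s := by
    rw [hs, sub_pos, exp_lt_one_iff]
    linarith
  have hl2 : exp (-2 * t) = exp (-t) ^ 2 := by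
    rw [← exp_nat_mul]
    congr 1
    push_cast
    ring
  set K := β * s + exp (-2 * t) with hK
  have hK0 : 0 < K := by positivity
  have hbound := lintegral_norm_sq_mul_ratio_le hint hVc hint2 hm2
    (continuous_gradient_of_contDiff hV) hβ hquad (exp_pos (-t)) hs0 (hK.trans (by rw [hl2]))
  rw [hf] at hbound
  have hZ0 : 0 < ∫ x, exp (-V x) := integral_exp_pos hint
  have hZ20 : 0 < ∫ x, exp (-(2 * V x)) := integral_exp_pos hint2
  have hgauss := exp_neg_mul_gaussian_le_integral hint hβ 0 _ (hquad 0)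
  rw [hf] at hgauss
  set Z := ∫ x, exp (-V x) with hZ
  set Z2 := ∫ x, exp (-(2 * V x)) with hZ2
  set M := ∫ x, ‖x‖ ^ 2 * exp (-V x) with hM
  have hM0 : 0 ≤ M := integral_nonneg fun _ => by positivity
  have hratio : ∀ z, ‖z‖ ^ 2 * (ouDensity d (fun x => 2 * V x) t z / ouDensity d V t z) =
      Z / Z2 * (‖z‖ ^ 2 *
        ((∫ x, exp (-‖z - exp (-t) • x‖ ^ 2 / (2 * s)) * exp (-(2 * V x))) /
          ∫ x, exp (-‖z - exp (-t) • x‖ ^ 2 / (2 * s)) * exp (-V x))) := fun z => by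
    simp only [ouDensity, ← mul_div_assoc, integral_div]
    rw [← hs, ← hZ, ← hZ2]
    have hc : 0 < (2 * π * s) ^ (-(d : ℝ) / 2) := by positivity
    field_simp
  simp_rw [hratio]
  have hZZ : 0 ≤ Z / Z2 := by positivity
  simp_rw [ENNReal.ofReal_mul hZZ]
  rw [lintegral_const_mul' _ _ ENNReal.ofReal_ne_top]
  refine (mul_le_mul_right hbound _).trans ?_
  rw [← ENNReal.ofReal_mul hZZ]
  refine ENNReal.ofReal_le_ofReal ?_
  have hexp : (K / exp (-t)) ^ (d + 2) = exp (t * (d + 2)) * K ^ (d + 2) := by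
    rw [div_pow, ← exp_nat_mul, div_eq_mul_inv, ← exp_neg, mul_comm]
    congr 2
    push_cast
    ring
  have hlog : 4 * Real.log (exp (-V 0) / Z) ≤ 2 * d * Real.log (β / (2 * π)) := by
    have h1 : exp (-V 0) * (2 * π / β) ^ (d / 2 : ℝ) ≤ Z := by
      refine le_trans ?_ hgauss
      have : 1 ≤ exp (‖gradient V 0‖ ^ 2 / (2 * β)) := one_le_exp (by positivity)
      gcongr
      exact le_mul_of_one_le_right (exp_pos _).le this
    have h2 : exp (-V 0) / Z ≤ (β / (2 * π)) ^ (d / 2 : ℝ) := by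
      rw [div_le_iff₀ hZ0]
      rw [← inv_div, inv_rpow (by positivity), ← div_eq_inv_mul, le_div_iff₀ (by positivity)]
      exact h1
    have h3 := Real.log_le_log hμ0 h2
    rw [Real.log_rpow (by positivity)] at h3
    linarith
  have hMn : ∫ x, ‖x‖ ^ 2 * (exp (-V x) / Z) = M / Z := by
    simp only [← mul_div_assoc, integral_div, hM]
  rw [hMn, hexp]
  have hd0 : (0 : ℝ) ≤ d * (β + 1) := by positivity
  calc _ = 2 * exp (t * (d + 2)) * (Z ^ 2 / Z2) * K ^ (d + 2) * (M / Z) := by field_simp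
    _ ≤ _ := by
      refine mul_le_mul_of_nonneg_left ?_ (by positivity)
      linarith
end
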